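/- In the Siegel setup, the conservative case (Φ not injective) occurs if and only if at least one of the following two conditions is satisfied: (1) Γ preserves a finite non-atomic measure on M whose support contains x₀; (2) there exists an element γ ∈ Γ of infinite order such that the set of non-wandering points of the diffeomorphism ρ(γ) contains a neighborhood of x₀. -/

import Mathlib

open Set Filter Topology MeasureTheory Matrix Function
noncomputable section
namespace Zeghib

/-- `ℝⁿ` (with the sup norm; the choice of norm is irrelevant). -/
abbrev V (n : ℕ) : Type := Fin n → ℝ

abbrev SLR (n : ℕ) := Matrix.SpecialLinearGroup (Fin n) ℝ
abbrev SLZ (n : ℕ) := Matrix.SpecialLinearGroup (Fin n) ℤ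

/-- The topology on `SL(n,ℝ)` induced from the space of matrices. -/
instance {n : ℕ} : TopologicalSpace (SLR n) :=
  TopologicalSpace.induced (fun g => (g : Matrix (Fin n) (Fin n) ℝ)) inferInstance

/-- The linear action of `SL(n,ℝ)` on `ℝⁿ`. -/
def lact {n : ℕ} (γ : SLR n) (u : V n) : V n := (γ : Matrix (Fin n) (Fin n) ℝ).mulVec u

lemma lact_mul {n : ℕ} (A B : SLR n) (v : V n) : lact (A * B) v = lact A (lact B v) := by
  simp only [lact, Matrix.SpecialLinearGroup.coe_mul]
  rw [Matrix.mulVec_mulVec]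

lemma lact_one {n : ℕ} (v : V n) : lact (1 : SLR n) v = v := by
  simp [lact]

/-- The coefficient-wise embedding `SL(n,ℤ) →* SL(n,ℝ)`. -/
def slCast {n : ℕ} : SLZ n →* SLR n := Matrix.SpecialLinearGroup.map (Int.castRingHom ℝ)

/-- `SL(n,ℤ)` viewed as a subgroup of `SL(n,ℝ)`. -/
def SLZR (n : ℕ) : Subgroup (SLR n) := MonoidHom.range (slCast (n := n))

/-- A subgroup `Δ` of a topological group `G` is a lattice if it is discrete and the
quotient `G ⧸ Δ` carries a nonzero finite `G`-invariant (Borel) measure. -/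
def IsLatticeIn (G : Type*) [Group G] [TopologicalSpace G] (Δ : Subgroup G) : Prop :=
  DiscreteTopology Δ ∧
    letI : MeasurableSpace (G ⧸ Δ) := borel _
    ∃ μ : Measure (G ⧸ Δ), μ ≠ 0 ∧ IsFiniteMeasure μ ∧
      ∀ g : G, Measure.map (fun x => g • x) μ = μ

/-- `Γ ≤ SL(n,ℝ)` is, up to an automorphism of (the topological group) `SL(n,ℝ)`,
a finite-index subgroup of `SL(n,ℤ)`. -/
def UpToAutoFiniteIndexSLZ {n : ℕ} (Γ : Subgroup (SLR n)) : Prop :=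
  ∃ σ : SLR n ≃* SLR n, Continuous σ ∧ Continuous σ.symm ∧
    Γ.map σ.toMonoidHom ≤ SLZR n ∧ ((Γ.map σ.toMonoidHom).subgroupOf (SLZR n)).FiniteIndex

section Charted

variable (E : Type*) [NormedAddCommGroup E] [NormedSpace ℝ E]
variable (E' : Type*) [NormedAddCommGroup E'] [NormedSpace ℝ E']
variable {M : Type*} [TopologicalSpace M] [ChartedSpace E M]
variable {M' : Type*} [TopologicalSpace M'] [ChartedSpace E' M']

/-- A map between charted spaces (over real normed vector spaces) is real analytic at a
point if it is continuous there and its representative in the preferred charts is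
real analytic. -/
def CAnalyticAt (f : M → M') (x : M) : Prop :=
  ContinuousAt f x ∧
    AnalyticAt ℝ ((chartAt E' (f x)) ∘ f ∘ (chartAt E x).symm) (chartAt E x x)

def CAnalyticOn (f : M → M') (s : Set M) : Prop := ∀ x ∈ s, CAnalyticAt E E' f x

def CAnalytic (f : M → M') : Prop := ∀ x, CAnalyticAt E E' f x

/-- A charted space is a real analytic manifold when all its transition maps are
real analytic. -/
def AnalyticCharts (M : Type*) [TopologicalSpace M] [ChartedSpace E M] : Prop :=
  ∀ x y : M, ∀ z ∈ ((chartAt E x).symm.trans (chartAt E y)).source,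
    AnalyticAt ℝ ((chartAt E y) ∘ (chartAt E x).symm) z

/-- `f` is, on `s`, a local analytic diffeomorphism (onto its image). -/
def LocalAnaDiffeoOn (f : M → M') (s : Set M) : Prop :=
  ∀ x ∈ s, ∃ U : Set M, IsOpen U ∧ x ∈ U ∧ U ⊆ s ∧ InjOn f U ∧ IsOpen (f '' U) ∧
    CAnalyticOn E E' f U ∧ ∃ g : M' → M, LeftInvOn g f U ∧ CAnalyticOn E' E g (f '' U)

/-- `f` restricted to `s` is a covering map onto its image. -/
def IsCoveringOntoImage (f : M → M') (s : Set M) : Prop :=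
  ∀ y ∈ f '' s, ∃ W : Set M', IsOpen W ∧ y ∈ W ∧
    ∃ (ι : Type) (U : ι → Set M), (∀ i, IsOpen (U i)) ∧
      Pairwise (Function.onFun Disjoint U) ∧ (s ∩ f ⁻¹' W = ⋃ i, U i) ∧
      ∀ i, BijOn f (U i) W

/-- An equivalence which is a real analytic diffeomorphism. -/
def IsAnaDiffeo (h : M ≃ M') : Prop := CAnalytic E E' h ∧ CAnalytic E' E h.symm

end Charted

/-- Star-shapedness with respect to the origin. -/
def StarShapedZero {n : ℕ} (s : Set (V n)) : Prop :=
  ∀ u ∈ s, ∀ t ∈ Icc (0:ℝ) 1, t • u ∈ s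

/-- `φ` extends, from a neighborhood of `0`, to an analytic local diffeomorphism
(onto its image) defined on `s`. -/
def ExtendsAsLocalAnaDiffeo {n : ℕ} {M : Type*} [TopologicalSpace M] [ChartedSpace (V n) M]
    (φ : V n → M) (s : Set (V n)) : Prop :=
  ∃ ψ : V n → M, (∀ᶠ u in 𝓝 (0 : V n), ψ u = φ u) ∧ LocalAnaDiffeoOn (V n) (V n) ψ s

/-- `(ℳ, Φ)` is an extension of the germ of the linearizing map `φ` to a connected
`r`-invariant open neighborhood `ℳ` of `0`, as an analytic local diffeomorphism
semi-conjugating the linear action `r` to the action `ρ`. -/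
def GoodExt {n : ℕ} {Γ : Type*} {M : Type*} [TopologicalSpace M] [ChartedSpace (V n) M]
    (r : Γ → V n → V n) (ρ : Γ → M → M) (φ : V n → M)
    (ℳ : Set (V n)) (Φ : V n → M) : Prop :=
  IsOpen ℳ ∧ IsConnected ℳ ∧ (0 : V n) ∈ ℳ ∧
  (∀ γ, ∀ u ∈ ℳ, r γ u ∈ ℳ) ∧
  (∀ᶠ u in 𝓝 (0 : V n), Φ u = φ u) ∧
  LocalAnaDiffeoOn (V n) (V n) Φ ℳ ∧
  (∀ γ, ∀ u ∈ ℳ, Φ (r γ u) = ρ γ (Φ u))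

/-- `φ` is an analytic diffeomorphism from an open neighborhood of `0 ∈ ℝⁿ` onto an open
neighborhood of its image, sending `0` to `x₀`. -/
def IsLocalLinearization {n : ℕ} {M : Type*} [TopologicalSpace M] [ChartedSpace (V n) M]
    (φ : V n → M) (x₀ : M) : Prop :=
  φ 0 = x₀ ∧
  ∃ U : Set (V n), IsOpen U ∧ (0 : V n) ∈ U ∧ InjOn φ U ∧ IsOpen (φ '' U) ∧
    CAnalyticOn (V n) (V n) φ U ∧
    ∃ ψ : M → V n, LeftInvOn ψ φ U ∧ CAnalyticOn (V n) (V n) ψ (φ '' U)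

/-- The Siegel setup: `Γ ≤ SL(n,ℝ)` acts analytically on the `n`-manifold `M` fixing `x₀`,
the infinitesimal representation at `x₀` is the canonical one, `φ` linearizes the action
near `x₀` (so that `φ ∘ γ = ρ(γ) ∘ φ` near `0`), and `(ℳ, Φ)` is a maximal extension of
`φ` to a connected invariant open subset of `ℝⁿ`, as an analytic local diffeomorphism
semi-conjugating the linear action to `ρ`. -/
def SiegelData {n : ℕ} (Γ : Subgroup (SLR n)) {M : Type*} [TopologicalSpace M]
    [ChartedSpace (V n) M] (ρ : Γ →* Equiv.Perm M) (x₀ : M) (φ : V n → M)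
    (ℳ : Set (V n)) (Φ : V n → M) : Prop :=
  (∀ γ : Γ, ρ γ x₀ = x₀) ∧
  IsLocalLinearization φ x₀ ∧
  (∀ γ : Γ, ∀ᶠ u in 𝓝 (0 : V n), φ (lact (γ : SLR n) u) = ρ γ (φ u)) ∧
  GoodExt (fun γ : Γ => lact (γ : SLR n)) (fun γ : Γ => ⇑(ρ γ)) φ ℳ Φ ∧
  (∀ (ℳ' : Set (V n)) (Φ' : V n → M),
    GoodExt (fun γ : Γ => lact (γ : SLR n)) (fun γ : Γ => ⇑(ρ γ)) φ ℳ' Φ' →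
    ℳ ⊆ ℳ' → ℳ' = ℳ)

/-- A point `x` is non-wandering for `f` if every neighborhood of `x` returns to itself
at arbitrarily large times. -/
def NonWanderingPt {X : Type*} [TopologicalSpace X] (f : X → X) (x : X) : Prop :=
  ∀ W ∈ 𝓝 x, ∀ N : ℕ, ∃ k ≥ N, (f^[k] '' W ∩ W).Nonempty

instance instIsTopologicalGroupSLR {n : ℕ} : IsTopologicalGroup (SLR n) :=
  @Matrix.SpecialLinearGroup.topologicalGroup (Fin n) ℝ _ _ _ _ _

instance instSecondCountableSLR {n : ℕ} : SecondCountableTopology (SLR n) :=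
  have : SecondCountableTopology (Matrix (Fin n) (Fin n) ℝ) :=
    inferInstanceAs (SecondCountableTopology (Fin n → Fin n → ℝ))
  TopologicalSpace.secondCountableTopology_induced _ _ _

lemma continuous_coe_SLR {n : ℕ} :
    Continuous (fun g : SLR n => (g : Matrix (Fin n) (Fin n) ℝ)) :=
  continuous_induced_dom

lemma continuous_lact {n : ℕ} : Continuous (fun p : SLR n × V n => lact p.1 p.2) := by
  unfold lact
  exact (continuous_coe_SLR.comp continuous_fst).matrix_mulVec continuous_snd

lemma lact_add {n : ℕ} (A : SLR n) (u v : V n) : lact A (u + v) = lact A u + lact A v :=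
  Matrix.mulVec_add _ _ _

lemma lact_smul {n : ℕ} (A : SLR n) (t : ℝ) (u : V n) : lact A (t • u) = t • lact A u :=
  Matrix.mulVec_smul _ _ _

lemma lact_zero {n : ℕ} (A : SLR n) : lact A (0 : V n) = 0 := Matrix.mulVec_zero _

lemma lact_inv_lact {n : ℕ} (A : SLR n) (u : V n) : lact A⁻¹ (lact A u) = u := by
  rw [← lact_mul, inv_mul_cancel, lact_one]

lemma lact_lact_inv {n : ℕ} (A : SLR n) (u : V n) : lact A (lact A⁻¹ u) = u := by
  rw [← lact_mul, mul_inv_cancel, lact_one]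

lemma lact_injective {n : ℕ} (A : SLR n) : Injective (lact A) :=
  (fun u v h => by rw [← lact_inv_lact A u, h, lact_inv_lact])

lemma continuous_lact_right {n : ℕ} (A : SLR n) : Continuous (lact A) :=
  continuous_lact.comp (continuous_const.prodMk continuous_id)

/-- `Returns Γ b ω m γ`: the elements `γ k = ω k * b ^ m k` of `Γ` shadow powers of `b` tending
to infinity, with error `ω k` tending to `1`. -/
structure Returns {n : ℕ} (Γ : Subgroup (SLR n)) (b : SLR n) (ω : ℕ → SLR n) (m : ℕ → ℕ)
    (γ : ℕ → SLR n) : Prop where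
  mem : ∀ k, γ k ∈ Γ
  exponent : Tendsto m atTop atTop
  error : Tendsto ω atTop (𝓝 1)
  eq : ∀ k, γ k = ω k * b ^ m k

lemma exists_returning_of_isLattice {n : ℕ} {Γ : Subgroup (SLR n)} (hlat : IsLatticeIn (SLR n) Γ)
    (a : SLR n) {O : Set (SLR n)} (hO : O ∈ 𝓝 1) :
    ∃ g ∈ O, ∀ W ∈ 𝓝 (1 : SLR n), ∀ N : ℕ, ∃ k ≥ N, ∃ w ∈ W, w * (g⁻¹ * a * g) ^ k ∈ Γ := by
  obtain ⟨-, μ, hμ0, hμf, hμ⟩ := hlat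
  let _ : MeasurableSpace (SLR n ⧸ Γ) := borel _
  have : BorelSpace (SLR n ⧸ Γ) := ⟨rfl⟩
  have := hμf
  have : SecondCountableTopology (SLR n ⧸ Γ) := inferInstance
  have hmp : ∀ g : SLR n, MeasurePreserving (fun x : SLR n ⧸ Γ => g • x) μ μ := fun g =>
    ⟨(continuous_const_smul g).measurable, hμ g⟩
  have hrec := (hmp a).conservative.ae_frequently_mem_of_mem_nhds
  have hopen : IsOpen ((↑) '' interior O : Set (SLR n ⧸ Γ)) :=
    QuotientGroup.isOpenMap_coe _ isOpen_interior
  have hex : ∃ x ∈ ((↑) '' interior O : Set (SLR n ⧸ Γ)),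
      ∀ s ∈ 𝓝 x, ∃ᶠ k in atTop, (fun x : SLR n ⧸ Γ => a • x)^[k] x ∈ s := by
    by_contra hcon
    push Not at hcon
    have hnull : μ ((↑) '' interior O : Set (SLR n ⧸ Γ)) = 0 := by
      refine measure_mono_null (fun x hx => ?_) (ae_iff.1 hrec)
      obtain ⟨s, hs, hs'⟩ := hcon x hx
      simp only [Set.mem_ofPred_eq, not_forall]
      exact ⟨s, hs, not_frequently.2 hs'⟩
    apply hμ0
    rw [← Measure.measure_univ_eq_zero]
    refine measure_null_of_locally_null _ fun x _ => ?_
    obtain ⟨g, rfl⟩ := QuotientGroup.mk_surjective x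
    refine ⟨(fun x : SLR n ⧸ Γ => g⁻¹ • x) ⁻¹' ((↑) '' interior O), ?_, ?_⟩
    · rw [nhdsWithin_univ]
      refine (hopen.preimage (continuous_const_smul _)).mem_nhds ⟨1, ?_, ?_⟩
      · exact mem_interior_iff_mem_nhds.2 hO
      · change _ = ((g⁻¹ * g : SLR n) : SLR n ⧸ Γ)
        rw [inv_mul_cancel]
    · rw [(hmp g⁻¹).measure_preimage hopen.measurableSet.nullMeasurableSet, hnull]
  obtain ⟨_, ⟨g, hg, rfl⟩, hret⟩ := hex
  refine ⟨g, interior_subset hg, fun W hW N => ?_⟩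
  have hs : ((↑) '' ((fun w : SLR n => g * w⁻¹) '' W) : Set (SLR n ⧸ Γ)) ∈ 𝓝 (g : SLR n ⧸ Γ) := by
    refine (QuotientGroup.isOpenMap_coe (N := Γ)).image_mem_nhds ?_
    have h1 : (fun x : SLR n => (x⁻¹ * g)) ⁻¹' W ∈ 𝓝 g := by
      refine ContinuousAt.preimage_mem_nhds (by fun_prop) ?_
      simpa using hW
    refine mem_of_superset h1 fun x hx => ⟨x⁻¹ * g, hx, by group⟩
  obtain ⟨k, hk, _, ⟨w, hw, rfl⟩, hk'⟩ := frequently_atTop.1 (hret _ hs) N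
  refine ⟨k, hk, w, hw, ?_⟩
  have hit : ∀ j : ℕ, (fun x : SLR n ⧸ Γ => a • x)^[j] (g : SLR n ⧸ Γ)
      = ((a ^ j * g : SLR n) : SLR n ⧸ Γ) := by
    intro j
    induction j with
    | zero => simp
    | succ j ih =>
      rw [Function.iterate_succ_apply', ih, pow_succ', mul_assoc]
      rfl
  rw [hit, QuotientGroup.eq] at hk'
  convert hk' using 1
  have : (g⁻¹ * a * g) ^ k = g⁻¹ * a ^ k * g := by
    have := conj_pow (i := k) (a := g⁻¹) (b := a)
    rwa [inv_inv] at this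
  rw [this]
  group

lemma exists_returns {n : ℕ} {Γ : Subgroup (SLR n)} (hlat : IsLatticeIn (SLR n) Γ)
    (a : SLR n) {O : Set (SLR n)} (hO : O ∈ 𝓝 1) :
    ∃ g ∈ O, ∃ ω m γ, Returns Γ (g⁻¹ * a * g) ω m γ := by
  obtain ⟨g, hg, h⟩ := exists_returning_of_isLattice hlat a hO
  obtain ⟨s, hs⟩ := (𝓝 (1 : SLR n)).exists_antitone_basis
  choose m hm w hw hmem using fun k : ℕ => h (s k) (hs.1.mem_of_mem trivial) k
  exact ⟨g, hg, w, m, _, hmem, tendsto_atTop_mono hm tendsto_id,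
    hs.tendsto hw, fun _ => rfl⟩

lemma det_one_add_vecMulVec {n : ℕ} (f φ : V n) : (1 + vecMulVec f φ).det = 1 + φ ⬝ᵥ f := by
  rw [vecMulVec_eq Unit, Matrix.det_one_add_replicateCol_mul_replicateRow]

lemma one_add_vecMulVec_mulVec {n : ℕ} (f φ x : V n) :
    (1 + vecMulVec f φ) *ᵥ x = x + (φ ⬝ᵥ x) • f := by
  rw [Matrix.add_mulVec, Matrix.one_mulVec, Matrix.vecMulVec_mulVec]
  simp

/-- The transvection `x ↦ x + φ(x) f`, where `φ(f) = 0`. -/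
def shear {n : ℕ} (f φ : V n) (h : φ ⬝ᵥ f = 0) : SLR n :=
  ⟨1 + vecMulVec f φ, by rw [det_one_add_vecMulVec, h, add_zero]⟩

lemma lact_shear {n : ℕ} (f φ : V n) (h : φ ⬝ᵥ f = 0) (x : V n) :
    lact (shear f φ h) x = x + (φ ⬝ᵥ x) • f :=
  one_add_vecMulVec_mulVec f φ x

lemma lact_shear_pow {n : ℕ} (f φ : V n) (h : φ ⬝ᵥ f = 0) (k : ℕ) (x : V n) :
    lact (shear f φ h ^ k) x = x + ((k : ℝ) * (φ ⬝ᵥ x)) • f := by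
  induction k with
  | zero => simp [lact_one]
  | succ k ih =>
    rw [pow_succ', lact_mul, ih, lact_shear, dotProduct_add, dotProduct_smul, h]
    push_cast
    rw [smul_zero, add_zero, add_assoc, ← add_smul]
    ring_nf

lemma lact_conj_pow {n : ℕ} (a g : SLR n) (k : ℕ) (x : V n) :
    lact ((g⁻¹ * a * g) ^ k) x = lact g⁻¹ (lact (a ^ k) (lact g x)) := by
  have := conj_pow (i := k) (a := g⁻¹) (b := a)
  rw [inv_inv] at this
  rw [this, lact_mul, lact_mul]

/-- The elements `γ k` asymptotically act like the transvections `x ↦ x + m k • φ(x) f`,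
up to errors `ω k` tending to `1`. -/
structure ShearReturns {n : ℕ} (Γ : Subgroup (SLR n)) (f φ : V n) (ω : ℕ → SLR n) (m : ℕ → ℕ)
    (γ : ℕ → SLR n) : Prop where
  mem : ∀ k, γ k ∈ Γ
  exponent : Tendsto m atTop atTop
  error : Tendsto ω atTop (𝓝 1)
  eq : ∀ k x, lact (γ k) x = lact (ω k) (x + ((m k : ℝ) * (φ ⬝ᵥ x)) • f)

lemma dotProduct_lact {n : ℕ} (φ x : V n) (g : SLR n) :
    φ ⬝ᵥ lact g x = (φ ᵥ* (g : Matrix (Fin n) (Fin n) ℝ)) ⬝ᵥ x :=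
  Matrix.dotProduct_mulVec _ _ _

lemma exists_shearReturns {n : ℕ} {Γ : Subgroup (SLR n)} (hlat : IsLatticeIn (SLR n) Γ)
    (f φ : V n) (h : φ ⬝ᵥ f = 0) {O : Set (SLR n)} (hO : O ∈ 𝓝 1) :
    ∃ g ∈ O, ∃ ω m γ, ShearReturns Γ (lact g⁻¹ f) (φ ᵥ* (g : Matrix (Fin n) (Fin n) ℝ)) ω m γ := by
  obtain ⟨g, hg, ω, m, γ, hr⟩ := exists_returns hlat (shear f φ h) hO
  refine ⟨g, hg, ω, m, γ, hr.mem, hr.exponent, hr.error, fun k x => ?_⟩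
  rw [hr.eq, lact_mul, lact_conj_pow, lact_shear_pow, lact_add, lact_smul, lact_inv_lact,
    dotProduct_lact]

lemma continuous_vecMul_coe {n : ℕ} (φ : V n) :
    Continuous fun g : SLR n => φ ᵥ* (g : Matrix (Fin n) (Fin n) ℝ) :=
  continuous_const.matrix_vecMul continuous_coe_SLR

/-- The elements of `Γ` can contract the hyperplane `ker ℓ` to `0`. -/
def Contracts {n : ℕ} (Γ : Subgroup (SLR n)) (ℓ : V n) : Prop :=
  ∃ γ : ℕ → SLR n, (∀ k, γ k ∈ Γ) ∧
    ∀ x, ℓ ⬝ᵥ x = 0 → Tendsto (fun k => lact (γ k) x) atTop (𝓝 0)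

lemma exists_half_on_ker {n : ℕ} {ℓ : V n} (hℓ : ℓ ≠ 0) :
    ∃ a : SLR n, ∀ k x, ℓ ⬝ᵥ x = 0 → lact (a ^ k) x = (1 / 2 : ℝ) ^ k • x := by
  have hne : ℓ ⬝ᵥ ℓ ≠ 0 := fun h => hℓ (dotProduct_self_eq_zero.1 h)
  let p : V n := ((2 ^ n - 1) / (ℓ ⬝ᵥ ℓ)) • ℓ
  have hdet : ((1 / 2 : ℝ) • (1 + vecMulVec p ℓ)).det = 1 := by
    rw [Matrix.det_smul, det_one_add_vecMulVec, dotProduct_smul, smul_eq_mul,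
      div_mul_cancel₀ _ hne, Fintype.card_fin, add_sub_cancel, ← mul_pow]
    norm_num
  obtain ⟨a, ha⟩ : ∃ a : SLR n, (a : Matrix (Fin n) (Fin n) ℝ)
      = (1 / 2 : ℝ) • (1 + vecMulVec p ℓ) := ⟨⟨_, hdet⟩, rfl⟩
  refine ⟨a, fun k x hx => ?_⟩
  induction k with
  | zero => simp [lact_one]
  | succ k ih =>
    rw [pow_succ', lact_mul, ih, lact_smul, pow_succ, mul_smul]
    congr 1
    rw [lact, ha, Matrix.smul_mulVec, one_add_vecMulVec_mulVec, hx, zero_smul, add_zero]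

lemma dense_contracts {n : ℕ} (hn : 0 < n) {Γ : Subgroup (SLR n)}
    (hlat : IsLatticeIn (SLR n) Γ) : Dense {ℓ : V n | Contracts Γ ℓ} := by
  have : NeZero n := ⟨hn.ne'⟩
  have hd : Dense ({0}ᶜ : Set (V n)) := dense_compl_singleton 0
  refine dense_closure.1 (hd.mono fun ℓ hℓ => ?_)
  obtain ⟨a, ha⟩ := exists_half_on_ker hℓ
  rw [mem_closure_iff_nhds]
  intro U hU
  have hO : (fun g : SLR n => ℓ ᵥ* (g : Matrix (Fin n) (Fin n) ℝ)) ⁻¹' U ∈ 𝓝 1 :=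
    (continuous_vecMul_coe ℓ).continuousAt.preimage_mem_nhds (by simpa using hU)
  obtain ⟨g, hg, ω, m, γ, hr⟩ := exists_returns hlat a hO
  refine ⟨_, hg, γ, hr.mem, fun x hx => ?_⟩
  rw [← dotProduct_lact] at hx
  have hlim : Tendsto (fun k => (1 / 2 : ℝ) ^ m k • x) atTop (𝓝 ((0 : ℝ) • x)) :=
    ((tendsto_pow_atTop_nhds_zero_of_lt_one (by norm_num) (by norm_num)).comp
      hr.exponent).smul_const x
  have := (continuous_lact.tendsto ((1 : SLR n), (0 : ℝ) • x)).comp (hr.error.prodMk_nhds hlim)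
  simp only [zero_smul, lact_zero] at this
  refine this.congr fun k => ?_
  rw [hr.eq, lact_mul, lact_conj_pow, ha _ _ hx, lact_smul, lact_inv_lact]
  rfl

/-- The part of the Siegel setup that is used here, with analyticity encoded through the local
transition maps `h` satisfying `Φ ∘ h = Φ`. -/
structure LinExt {n : ℕ} (Γ : Subgroup (SLR n)) {M : Type*} [TopologicalSpace M]
    (ρ : Γ → M → M) (ℳ : Set (V n)) (Φ : V n → M) : Prop where
  isOpen : IsOpen ℳ
  zero_mem : (0 : V n) ∈ ℳ
  lact_mem : ∀ γ ∈ Γ, ∀ u ∈ ℳ, lact γ u ∈ ℳ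
  map_lact : ∀ γ : Γ, ∀ u ∈ ℳ, Φ (lact (γ : SLR n) u) = ρ γ (Φ u)
  continuousOn : ContinuousOn Φ ℳ
  locInj : ∀ x ∈ ℳ, ∃ U ∈ 𝓝 x, InjOn Φ U
  image_mem_nhds : ∀ x ∈ ℳ, ∀ U ∈ 𝓝 x, Φ '' U ∈ 𝓝 (Φ x)
  germ : ∀ u ∈ ℳ, ∀ v ∈ ℳ, Φ u = Φ v →
    ∃ h : V n → V n, AnalyticAt ℝ h u ∧ h u = v ∧ ∀ᶠ x in 𝓝 u, Φ (h x) = Φ x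

section

variable {n : ℕ} {Γ : Subgroup (SLR n)} {M : Type*} [TopologicalSpace M]
  {ρ : Γ → M → M} {ℳ : Set (V n)} {Φ : V n → M}

namespace LinExt

lemma mem_nhds (hX : LinExt Γ ρ ℳ Φ) {x : V n} (hx : x ∈ ℳ) : ℳ ∈ 𝓝 x := hX.isOpen.mem_nhds hx

lemma mem_of_lact_mem (hX : LinExt Γ ρ ℳ Φ) {γ : SLR n} (hγ : γ ∈ Γ) {x : V n}
    (hx : lact γ x ∈ ℳ) : x ∈ ℳ := by
  simpa [lact_inv_lact] using hX.lact_mem γ⁻¹ (Γ.inv_mem hγ) _ hx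

lemma map_lact_eq (hX : LinExt Γ ρ ℳ Φ) {γ : SLR n} (hγ : γ ∈ Γ) {x y : V n} (hx : x ∈ ℳ)
    (hy : y ∈ ℳ) (h : Φ x = Φ y) : Φ (lact γ x) = Φ (lact γ y) := by
  rw [hX.map_lact ⟨γ, hγ⟩ x hx, hX.map_lact ⟨γ, hγ⟩ y hy, h]

lemma mem_of_contracts (hX : LinExt Γ ρ ℳ Φ) {ℓ x : V n} (hℓ : Contracts Γ ℓ)
    (hx : ℓ ⬝ᵥ x = 0) : x ∈ ℳ := by
  obtain ⟨γ, hγ, h⟩ := hℓ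
  obtain ⟨k, hk⟩ := ((h x hx).eventually (hX.mem_nhds hX.zero_mem)).exists
  exact hX.mem_of_lact_mem (hγ k) hk

lemma injOn_of_contracts (hX : LinExt Γ ρ ℳ Φ) {ℓ x y : V n} (hℓ : Contracts Γ ℓ)
    (hx : ℓ ⬝ᵥ x = 0) (hy : ℓ ⬝ᵥ y = 0) (hxy : Φ x = Φ y) : x = y := by
  have hxM := hX.mem_of_contracts hℓ hx
  have hyM := hX.mem_of_contracts hℓ hy
  obtain ⟨γ, hγ, h⟩ := hℓ
  obtain ⟨U, hU, hinj⟩ := hX.locInj 0 hX.zero_mem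
  obtain ⟨k, hk, hk'⟩ := (((h x hx).eventually hU).and ((h y hy).eventually hU)).exists
  exact lact_injective (γ k) (hinj hk hk' (hX.map_lact_eq (hγ k) hxM hyM hxy))

end LinExt

/-- A covector, a base point and two directions. -/
abbrev PlaneData (n : ℕ) : Type := V n × V n × V n × V n

/-- A pair of parametrized planes. -/
abbrev PlanePair (n : ℕ) : Type := PlaneData n × PlaneData n

/-- The affine parametrization `(z, s) ↦ p + z d₁ + s d₂`, all data being variable. -/
def planePt (p : PlaneData n) (zs : ℝ × ℝ) : V n :=
  p.2.1 + zs.1 • p.2.2.1 + zs.2 • p.2.2.2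

lemma exists_common_zero {h : V n → V n} {u f θ : V n} (hh : AnalyticAt ℝ h u)
    (hθu : θ ⬝ᵥ h u = 0) (hθf : θ ⬝ᵥ (fderiv ℝ h u f) ≠ 0)
    {p₁ p₂ : ℕ → PlaneData n} (h₁ : Tendsto p₁ atTop (𝓝 (θ, u, f, 0)))
    (h₂ : Tendsto p₂ atTop (𝓝 (θ, u, f, f))) {U : Set (V n)} (hU : U ∈ 𝓝 u) :
    ∀ᶠ k in atTop, ∃ zs : ℝ × ℝ, planePt (p₁ k) zs ∈ U ∧ planePt (p₂ k) zs ∈ U ∧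
      (p₁ k).1 ⬝ᵥ h (planePt (p₁ k) zs) = 0 ∧ (p₂ k).1 ⬝ᵥ h (planePt (p₂ k) zs) = 0 := by
  let F : PlaneData n → ℝ × ℝ → ℝ := fun p zs => p.1 ⬝ᵥ h (planePt p zs)
  let G : PlanePair n × (ℝ × ℝ) → PlanePair n × (ℝ × ℝ) :=
    fun w => (w.1, (F w.1.1 w.2, F w.1.2 w.2))
  let p₀ : PlaneData n × PlaneData n := ((θ, u, f, 0), (θ, u, f, f))
  have hpt₁ : planePt p₀.1 (0 : ℝ × ℝ) = u := by simp [planePt, p₀]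
  have hpt₂ : planePt p₀.2 (0 : ℝ × ℝ) = u := by simp [planePt, p₀]
  have hF : ∀ w : PlaneData n × (ℝ × ℝ), planePt w.1 w.2 = u →
      ContDiffAt ℝ 1 (fun w : PlaneData n × (ℝ × ℝ) => F w.1 w.2) w := by
    intro w hw
    have hc : ContDiffAt ℝ 1 (fun w : PlaneData n × (ℝ × ℝ) => h (planePt w.1 w.2)) w := by
      refine ContDiffAt.comp (g := h) w (by rw [hw]; exact hh.contDiffAt) ?_
      unfold planePt
      fun_prop
    change ContDiffAt ℝ 1 (fun w : PlaneData n × (ℝ × ℝ) => ∑ i, w.1.1 i * h (planePt w.1 w.2) i) w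
    exact ContDiffAt.sum fun i _ => ContDiffAt.mul (by fun_prop) (contDiffAt_pi.1 hc i)
  have hG : ContDiffAt ℝ 1 G (p₀, 0) := by
    refine contDiffAt_fst.prodMk (ContDiffAt.prodMk ?_ ?_)
    · exact ContDiffAt.comp (g := fun w : PlaneData n × (ℝ × ℝ) => F w.1 w.2)
        (f := fun w : PlanePair n × (ℝ × ℝ) => (w.1.1, w.2)) _ (hF _ hpt₁) (by fun_prop)
    · exact ContDiffAt.comp (g := fun w : PlaneData n × (ℝ × ℝ) => F w.1 w.2)
        (f := fun w : PlanePair n × (ℝ × ℝ) => (w.1.2, w.2)) _ (hF _ hpt₂) (by fun_prop)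
  set L := fderiv ℝ G (p₀, 0) with hL
  have hGd : HasFDerivAt G L (p₀, 0) := (hG.differentiableAt one_ne_zero).hasFDerivAt
  set c := θ ⬝ᵥ (fderiv ℝ h u f) with hc
  have hline : ∀ z : ℝ, HasDerivAt (fun t : ℝ => θ ⬝ᵥ h (u + t • (z • f))) (z * c) 0 := by
    intro z
    have h1 : HasDerivAt (fun t : ℝ => u + t • (z • f)) (z • f) 0 := by
      simpa using ((hasDerivAt_id (0 : ℝ)).smul_const (z • f)).const_add u
    have h2 : HasFDerivAt h (fderiv ℝ h u) (u + (0 : ℝ) • (z • f)) := by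
      simpa using hh.differentiableAt.hasFDerivAt
    have h3 := h2.comp_hasDerivAt (0 : ℝ) h1
    have h4 : ∀ i, HasDerivAt (fun t : ℝ => θ i * h (u + t • (z • f)) i)
        (θ i * (fderiv ℝ h u (z • f)) i) 0 := fun i => ((hasDerivAt_pi.1 h3 i).const_mul _)
    have h5 := HasDerivAt.fun_sum (u := Finset.univ) fun i _ => h4 i
    have h6 : z * c = ∑ i, θ i * (fderiv ℝ h u (z • f)) i := by
      rw [hc, ← smul_eq_mul, ← dotProduct_smul, ← map_smul]
      rfl
    rw [h6]
    exact h5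
  have hL2 : ∀ z s : ℝ, L (0, (z, s)) = (0, (z * c, (z + s) * c)) := by
    intro z s
    have h1 : HasDerivAt (fun t : ℝ => ((p₀, (t * z, t * s)) : PlanePair n × (ℝ × ℝ)))
        (0, (z, s)) 0 := by
      refine (hasDerivAt_const _ _).prodMk (HasDerivAt.prodMk ?_ ?_)
      · simpa using (hasDerivAt_id (0 : ℝ)).mul_const z
      · simpa using (hasDerivAt_id (0 : ℝ)).mul_const s
    have h2 : HasFDerivAt G L (p₀, ((0 : ℝ) * z, (0 : ℝ) * s)) := by
      have : (((0 : ℝ) * z, (0 : ℝ) * s) : ℝ × ℝ) = 0 := by simp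
      rw [this]
      exact hGd
    have h3 := h2.comp_hasDerivAt (0 : ℝ) h1
    have h4 : HasDerivAt (fun t : ℝ => G (p₀, (t * z, t * s))) (0, (z * c, (z + s) * c)) 0 := by
      refine (hasDerivAt_const _ _).prodMk (HasDerivAt.prodMk ?_ ?_)
      · refine (hline z).congr_of_eventuallyEq (Eventually.of_forall fun t => ?_)
        simp [F, planePt, p₀, mul_smul]
      · refine (hline (z + s)).congr_of_eventuallyEq (Eventually.of_forall fun t => ?_)
        simp [F, planePt, p₀, mul_smul, add_smul, add_assoc]
    exact h3.unique h4
  have hL1 : ∀ w, (L w).1 = w.1 := by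
    intro w
    have h1 : HasFDerivAt (fun w => (G w).1)
        ((ContinuousLinearMap.fst ℝ (PlanePair n) (ℝ × ℝ)).comp L) (p₀, 0) := hGd.fst
    have h2 : HasFDerivAt (fun w => (G w).1) (ContinuousLinearMap.fst ℝ (PlanePair n) (ℝ × ℝ))
        (p₀, 0) := hasFDerivAt_fst
    exact DFunLike.congr_fun (h1.unique h2) w
  have hsurj : (L : PlanePair n × (ℝ × ℝ) →ₗ[ℝ] PlanePair n × (ℝ × ℝ)).range = ⊤ := by
    rw [LinearMap.range_eq_top]
    rintro ⟨dp, e⟩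
    obtain ⟨e', he'⟩ : ∃ e', L (dp, 0) = (dp, e') := ⟨(L (dp, 0)).2, Prod.ext (hL1 _) rfl⟩
    refine ⟨(dp, ((e - e').1 / c, (e - e').2 / c - (e - e').1 / c)), ?_⟩
    have : ((dp, ((e - e').1 / c, (e - e').2 / c - (e - e').1 / c)) : PlanePair n × (ℝ × ℝ))
        = (dp, 0) + (0, ((e - e').1 / c, (e - e').2 / c - (e - e').1 / c)) := by simp
    rw [this]
    change L _ = _
    rw [map_add, he', hL2]
    ext <;> simp [hθf]
  have hGs : HasStrictFDerivAt G L (p₀, 0) := hG.hasStrictFDerivAt one_ne_zero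
  have hmap := hGs.map_nhds_eq_of_surj hsurj
  have hG0 : G (p₀, 0) = (p₀, (0, 0)) := by
    simp only [G, F, hpt₁, hpt₂]
    simp [p₀, hθu]
  have hB : {w : PlanePair n × (ℝ × ℝ) | planePt w.1.1 w.2 ∈ U ∧ planePt w.1.2 w.2 ∈ U}
      ∈ 𝓝 (p₀, (0 : ℝ × ℝ)) := by
    refine inter_mem ?_ ?_
    · have : ContinuousAt (fun w : PlanePair n × (ℝ × ℝ) => planePt w.1.1 w.2) (p₀, 0) := by
        unfold planePt; fun_prop
      exact this.preimage_mem_nhds (by simpa only [hpt₁] using hU)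
    · have : ContinuousAt (fun w : PlanePair n × (ℝ × ℝ) => planePt w.1.2 w.2) (p₀, 0) := by
        unfold planePt; fun_prop
      exact this.preimage_mem_nhds (by simpa only [hpt₂] using hU)
  have hGB := image_mem_map (m := G) hB
  rw [hmap, hG0] at hGB
  have hlim : Tendsto (fun k => ((p₁ k, p₂ k), ((0 : ℝ), (0 : ℝ)))) atTop (𝓝 (p₀, (0, 0))) :=
    (h₁.prodMk_nhds h₂).prodMk_nhds tendsto_const_nhds
  filter_upwards [hlim hGB] with k hk
  obtain ⟨⟨⟨q₁, q₂⟩, zs⟩, hw, hw'⟩ := hk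
  simp only [G, Prod.mk.injEq] at hw'
  obtain ⟨⟨rfl, rfl⟩, h3, h4⟩ := hw'
  exact ⟨zs, hw.1, hw.2, h3, h4⟩

end

section

variable {n : ℕ} {Γ : Subgroup (SLR n)} {M : Type*} [TopologicalSpace M]
  {ρ : Γ → M → M} {ℳ : Set (V n)} {Φ : V n → M}

lemma tendsto_lact {α : Type*} {l : Filter α} {A : α → SLR n} {B : SLR n} {x : α → V n} {y : V n}
    (hA : Tendsto A l (𝓝 B)) (hx : Tendsto x l (𝓝 y)) :
    Tendsto (fun k => lact (A k) (x k)) l (𝓝 (lact B y)) :=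
  (continuous_lact.tendsto (B, y)).comp (hA.prodMk_nhds hx)

lemma vecMul_inv_mul {f φ θ : V n} {ω : ℕ → SLR n} {m : ℕ → ℕ} {γ : ℕ → SLR n}
    (hr : ShearReturns Γ f φ ω m γ) (hθf : θ ⬝ᵥ f = 0) (k : ℕ) :
    (θ ᵥ* ((ω k)⁻¹ : SLR n)) ᵥ* (γ k : Matrix (Fin n) (Fin n) ℝ) = θ := by
  refine dotProduct_eq _ _ fun x => ?_
  rw [← dotProduct_lact, ← dotProduct_lact, hr.eq, lact_inv_lact, dotProduct_add,
    dotProduct_smul, hθf, smul_zero, add_zero]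

lemma exists_contracts_near (hn : 0 < n) (hlat : IsLatticeIn (SLR n) Γ)
    {f φ θ : V n} {ω : ℕ → SLR n} {m : ℕ → ℕ} {γ : ℕ → SLR n}
    (hr : ShearReturns Γ f φ ω m γ) (hθf : θ ⬝ᵥ f = 0) :
    ∃ ℓ : ℕ → V n, (∀ k, Contracts Γ (ℓ k)) ∧ Tendsto ℓ atTop (𝓝 θ) ∧
      Tendsto (fun k => ℓ k ᵥ* (γ k : Matrix (Fin n) (Fin n) ℝ)) atTop (𝓝 θ) := by
  have hex : ∀ k : ℕ, ∃ ℓ : V n, Contracts Γ ℓ ∧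
      dist ℓ (θ ᵥ* ((ω k)⁻¹ : SLR n)) < 1 / ((k : ℝ) + 1) ∧
      dist (ℓ ᵥ* (γ k : Matrix (Fin n) (Fin n) ℝ)) θ < 1 / ((k : ℝ) + 1) := by
    intro k
    have hpos : (0 : ℝ) < 1 / ((k : ℝ) + 1) := by positivity
    have hc : Continuous fun ℓ : V n => ℓ ᵥ* (γ k : Matrix (Fin n) (Fin n) ℝ) :=
      continuous_id.matrix_vecMul continuous_const
    have hev : ∀ᶠ ℓ in 𝓝 (θ ᵥ* ((ω k)⁻¹ : SLR n)),
        dist ℓ (θ ᵥ* ((ω k)⁻¹ : SLR n)) < 1 / ((k : ℝ) + 1) ∧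
        dist (ℓ ᵥ* (γ k : Matrix (Fin n) (Fin n) ℝ)) θ < 1 / ((k : ℝ) + 1) := by
      refine Eventually.and (Metric.ball_mem_nhds _ hpos) ?_
      have hct := hc.tendsto (θ ᵥ* ((ω k)⁻¹ : SLR n))
      rw [vecMul_inv_mul hr hθf] at hct
      exact hct.eventually (Metric.ball_mem_nhds _ hpos)
    obtain ⟨ℓ, h1, h2⟩ := mem_closure_iff_nhds.1 ((dense_contracts hn hlat).closure_eq ▸
      mem_univ (θ ᵥ* ((ω k)⁻¹ : SLR n)) ) _ hev
    exact ⟨ℓ, h2, h1⟩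
  choose ℓ hℓ h1 h2 using hex
  refine ⟨ℓ, hℓ, ?_, ?_⟩
  · have hlim : Tendsto (fun k => θ ᵥ* ((ω k)⁻¹ : SLR n)) atTop (𝓝 θ) := by
      have := ((continuous_vecMul_coe θ).tendsto _).comp hr.error.inv
      rwa [inv_one, Matrix.SpecialLinearGroup.coe_one, Matrix.vecMul_one] at this
    refine hlim.congr_dist ?_
    refine squeeze_zero (fun _ => dist_nonneg) (fun k => ?_) tendsto_one_div_add_atTop_nhds_zero_nat
    rw [dist_comm]
    exact (h1 k).le
  · rw [tendsto_iff_dist_tendsto_zero]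
    exact squeeze_zero (fun _ => dist_nonneg) (fun k => (h2 k).le)
      tendsto_one_div_add_atTop_nhds_zero_nat

lemma LinExt.false_of_shearReturns (hX : LinExt Γ ρ ℳ Φ) (hn : 0 < n)
    (hlat : IsLatticeIn (SLR n) Γ) {f φ θ u : V n} {ω : ℕ → SLR n} {m : ℕ → ℕ} {γ : ℕ → SLR n}
    (hr : ShearReturns Γ f φ ω m γ) {h : V n → V n} (hu : u ∈ ℳ) (hhu : h u ∈ ℳ)
    (hh : AnalyticAt ℝ h u) (hΦ : ∀ᶠ x in 𝓝 u, Φ (h x) = Φ x) (hφu : φ ⬝ᵥ u = 0)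
    (hφf : φ ⬝ᵥ f = 0) (hφv : φ ⬝ᵥ h u ≠ 0) (hθf : θ ⬝ᵥ f = 0) (hθv : θ ⬝ᵥ h u = 0)
    (hθD : θ ⬝ᵥ fderiv ℝ h u f ≠ 0) : False := by
  obtain ⟨ℓ, hℓ, hlim, hlim'⟩ := exists_contracts_near hn hlat hr hθf
  have hf : f ≠ 0 := by
    rintro rfl
    simp at hθD
  set q : V n := (φ ⬝ᵥ h u)⁻¹ • h u with hq
  have hφq : φ ⬝ᵥ q = 1 := by rw [hq, dotProduct_smul, smul_eq_mul, inv_mul_cancel₀ hφv]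
  have hm : Tendsto (fun k => (m k : ℝ)) atTop atTop :=
    tendsto_natCast_atTop_atTop.comp hr.exponent
  have hminv : Tendsto (fun k => (m k : ℝ)⁻¹ • q) atTop (𝓝 0) := by
    simpa using (tendsto_inv_atTop_zero.comp hm).smul_const q
  have hωc : ∀ x : V n, Tendsto (fun k => lact (ω k) x) atTop (𝓝 x) := fun x => by
    simpa only [lact_one] using tendsto_lact hr.error (tendsto_const_nhds (x := x))
  have hωq : Tendsto (fun k => lact (ω k) ((m k : ℝ)⁻¹ • q)) atTop (𝓝 0) := by
    simpa only [lact_zero] using tendsto_lact hr.error hminv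
  let p₁ : ℕ → PlaneData n := fun k =>
    (ℓ k ᵥ* (γ k : Matrix (Fin n) (Fin n) ℝ), u, f, (m k : ℝ)⁻¹ • q)
  let p₂ : ℕ → PlaneData n := fun k =>
    (ℓ k, lact (ω k) u, lact (ω k) f, lact (ω k) ((m k : ℝ)⁻¹ • q) + lact (ω k) f)
  have h₁ : Tendsto p₁ atTop (𝓝 (θ, u, f, 0)) :=
    hlim'.prodMk_nhds (tendsto_const_nhds.prodMk_nhds (tendsto_const_nhds.prodMk_nhds hminv))
  have h₂ : Tendsto p₂ atTop (𝓝 (θ, u, f, f)) := by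
    refine hlim.prodMk_nhds ((hωc u).prodMk_nhds ((hωc f).prodMk_nhds ?_))
    simpa using hωq.add (hωc f)
  have hnear : ∀ᶠ w in 𝓝 (1 : SLR n) ×ˢ 𝓝 u, dist (lact w.1⁻¹ (h w.2)) (h u) < 1 := by
    have hcont := tendsto_lact (tendsto_fst (f := 𝓝 (1 : SLR n)) (g := 𝓝 u)).inv
      (hh.continuousAt.tendsto.comp tendsto_snd)
    rw [inv_one, lact_one] at hcont
    exact hcont.eventually (Metric.ball_mem_nhds _ one_pos)
  rw [eventually_prod_iff] at hnear
  obtain ⟨pω, hpω, px, hpx, hpp⟩ := hnear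
  set c := |φ ⬝ᵥ h u| / 2 with hc
  have hc0 : 0 < c := by positivity
  have hφc : ∀ᶠ x in 𝓝 u, c < |φ ⬝ᵥ h x| := by
    have : ContinuousAt (fun x => |φ ⬝ᵥ h x|) u :=
      (Continuous.comp (g := fun y : V n => |φ ⬝ᵥ y|) (by fun_prop) continuous_id).continuousAt.comp
        hh.continuousAt
    exact this.eventually (lt_mem_nhds (by rw [hc]; exact half_lt_self (abs_pos.2 hφv)))
  have hU : ∀ᶠ x in 𝓝 u, x ∈ ℳ ∧ h x ∈ ℳ ∧ Φ (h x) = Φ x ∧ px x ∧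
      dist (h x) (h u) < 1 ∧ c < |φ ⬝ᵥ h x| :=
    Eventually.and (hX.mem_nhds hu) <| (hh.continuousAt.eventually (hX.mem_nhds hhu)).and <|
      hΦ.and <| hpx.and <| (hh.continuousAt.eventually (Metric.ball_mem_nhds _ one_pos)).and hφc
  have hbig : ∀ᶠ k in atTop, 2 / (c * ‖f‖) < (m k : ℝ) := hm.eventually (eventually_gt_atTop _)
  obtain ⟨k, ⟨zs, hy, hx, hηy, hℓx⟩, hωk, hmk⟩ :=
    ((exists_common_zero hh hθv hθD h₁ h₂ hU).and ((hr.error.eventually hpω).and hbig)).exists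
  set y := planePt (p₁ k) zs with hydef
  set x := planePt (p₂ k) zs with hxdef
  have hfpos : 0 < ‖f‖ := norm_pos_iff.2 hf
  have hm0 : (0 : ℝ) < m k := lt_trans (by positivity) hmk
  have hφy : (m k : ℝ) * (φ ⬝ᵥ y) = zs.2 := by
    simp only [hydef, p₁, planePt, dotProduct_add, dotProduct_smul, hφu, hφf, hφq, smul_eq_mul]
    field_simp
    ring
  have hγy : lact (γ k) y = x := by
    rw [hr.eq, hφy]
    simp only [hydef, hxdef, p₁, p₂, planePt, lact_add, lact_smul, smul_add, add_assoc]
  have hηy' : ℓ k ⬝ᵥ lact (γ k) (h y) = 0 := by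
    rw [dotProduct_lact]
    exact hηy
  have hxy : h x = lact (γ k) (h y) := by
    refine hX.injOn_of_contracts (hℓ k) hℓx hηy' ?_
    rw [hx.2.2.1, ← hγy]
    exact hX.map_lact_eq (hr.mem k) hy.1 hy.2.1 hy.2.2.1.symm
  rw [hr.eq] at hxy
  have h3 : lact (ω k)⁻¹ (h x) = h y + ((m k : ℝ) * (φ ⬝ᵥ h y)) • f := by
    rw [hxy, lact_inv_lact]
  have h4 := hpp hωk hx.2.2.2.1
  dsimp only at h4
  rw [h3] at h4
  have h5 : ‖((m k : ℝ) * (φ ⬝ᵥ h y)) • f‖ < 2 := by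
    calc _ = dist (h y + ((m k : ℝ) * (φ ⬝ᵥ h y)) • f) (h y) := by simp [dist_eq_norm]
      _ ≤ dist (h y + ((m k : ℝ) * (φ ⬝ᵥ h y)) • f) (h u) + dist (h y) (h u) :=
        dist_triangle_right _ _ _
      _ < 1 + 1 := add_lt_add h4 hy.2.2.2.2.1
      _ = 2 := by norm_num
  rw [norm_smul, norm_mul, Real.norm_natCast, Real.norm_eq_abs] at h5
  rw [div_lt_iff₀ (by positivity)] at hmk
  have h6 : (m k : ℝ) * c * ‖f‖ ≤ m k * |φ ⬝ᵥ h y| * ‖f‖ := by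
    have := hy.2.2.2.2.2.le
    gcongr
  linarith

end

section

variable {n : ℕ} {Γ : Subgroup (SLR n)} {M : Type*} [TopologicalSpace M]
  {ρ : Γ → M → M} {ℳ : Set (V n)} {Φ : V n → M}

/-- `h` is an analytic germ at `u` preserving the fibres of `Φ`. -/
structure IsDeckGerm (ℳ : Set (V n)) (Φ : V n → M) (h : V n → V n) (u : V n) : Prop where
  analyticAt : AnalyticAt ℝ h u
  mem : u ∈ ℳ
  map_mem : h u ∈ ℳ
  eventually_eq : ∀ᶠ x in 𝓝 u, Φ (h x) = Φ x

omit [TopologicalSpace M] in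
lemma IsDeckGerm.eventually {h : V n → V n} {u : V n} (hℳ : IsOpen ℳ)
    (H : IsDeckGerm ℳ Φ h u) : ∀ᶠ x in 𝓝 u, IsDeckGerm ℳ Φ h x := by
  filter_upwards [H.analyticAt.eventually_analyticAt, hℳ.mem_nhds H.mem,
    H.analyticAt.continuousAt.preimage_mem_nhds (hℳ.mem_nhds H.map_mem),
    H.eventually_eq.eventually_nhds] with x h1 h2 h3 h4
  exact ⟨h1, h2, h3, h4⟩

lemma exists_dotProduct_ne_zero_of_notMem {p : Submodule ℝ (V n)} {v : V n} (hv : v ∉ p) :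
    ∃ φ : V n, φ ⬝ᵥ v ≠ 0 ∧ ∀ x ∈ p, φ ⬝ᵥ x = 0 := by
  obtain ⟨f, hf, hp⟩ := Submodule.exists_le_ker_of_notMem hv
  have : ∀ x, (dotProductEquiv ℝ (Fin n)).symm f ⬝ᵥ x = f x := fun x =>
    DFunLike.congr_fun ((dotProductEquiv ℝ (Fin n)).apply_symm_apply f) x
  exact ⟨(dotProductEquiv ℝ (Fin n)).symm f, by rwa [this], fun x hx => by
    rw [this]; exact hp hx⟩

lemma IsDeckGerm.dotProduct_fderiv_eq_zero (hX : LinExt Γ ρ ℳ Φ) (hn : 0 < n)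
    (hlat : IsLatticeIn (SLR n) Γ) {h : V n → V n} {u e η : V n} (H : IsDeckGerm ℳ Φ h u)
    (hvu : h u ∉ Submodule.span ℝ {u}) (he : e ∉ Submodule.span ℝ {h u, u})
    (hηe : η ⬝ᵥ e = 0) (hηv : η ⬝ᵥ h u = 0) : η ⬝ᵥ fderiv ℝ h u e = 0 := by
  by_contra hne
  obtain ⟨φ, hφv, hφ⟩ := exists_dotProduct_ne_zero_of_notMem
    (p := Submodule.span ℝ {e, u}) (v := h u)
    (fun hmem => he (mem_span_insert_exchange hmem hvu))
  have hφe : φ ⬝ᵥ e = 0 := hφ e (Submodule.subset_span (by simp))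
  have hφu : φ ⬝ᵥ u = 0 := hφ u (Submodule.subset_span (by simp))
  have hid : Tendsto (fun g : SLR n => g) (𝓝 1) (𝓝 1) := tendsto_id
  have hinv : Tendsto (fun g : SLR n => g⁻¹) (𝓝 1) (𝓝 1) := by simpa using hid.inv
  have hu : Tendsto (fun g : SLR n => lact g⁻¹ u) (𝓝 1) (𝓝 u) := by
    simpa only [lact_one] using tendsto_lact hinv (tendsto_const_nhds (x := u))
  have hf : Tendsto (fun g : SLR n => lact g⁻¹ e) (𝓝 1) (𝓝 e) := by
    simpa only [lact_one] using tendsto_lact hinv (tendsto_const_nhds (x := e))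
  have hv : Tendsto (fun g : SLR n => lact g (h (lact g⁻¹ u))) (𝓝 1) (𝓝 (h u)) := by
    simpa only [lact_one] using
      tendsto_lact (x := fun g => h (lact g⁻¹ u)) hid (H.analyticAt.continuousAt.tendsto.comp hu)
  have hD : Tendsto (fun g : SLR n => lact g (fderiv ℝ h (lact g⁻¹ u) (lact g⁻¹ e))) (𝓝 1)
      (𝓝 (fderiv ℝ h u e)) := by
    have hDu : Tendsto (fun g : SLR n => fderiv ℝ h (lact g⁻¹ u)) (𝓝 1) (𝓝 (fderiv ℝ h u)) :=
      H.analyticAt.fderiv.continuousAt.tendsto.comp hu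
    have hDe : Tendsto (fun g : SLR n => fderiv ℝ h (lact g⁻¹ u) (lact g⁻¹ e)) (𝓝 1)
        (𝓝 (fderiv ℝ h u e)) :=
      (isBoundedBilinearMap_apply.continuous.tendsto (fderiv ℝ h u, e)).comp (hDu.prodMk_nhds hf)
    simpa only [lact_one] using tendsto_lact hid hDe
  have hdot : ∀ ξ : V n, Continuous fun x : V n => ξ ⬝ᵥ x := fun ξ => by fun_prop
  have hφv' := ((hdot φ).tendsto _).comp hv
  have hlim : Tendsto (fun g : SLR n =>
      η ⬝ᵥ lact g (fderiv ℝ h (lact g⁻¹ u) (lact g⁻¹ e)) -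
        (η ⬝ᵥ lact g (h (lact g⁻¹ u)) / φ ⬝ᵥ lact g (h (lact g⁻¹ u))) *
          φ ⬝ᵥ lact g (fderiv ℝ h (lact g⁻¹ u) (lact g⁻¹ e))) (𝓝 1)
      (𝓝 (η ⬝ᵥ fderiv ℝ h u e - (η ⬝ᵥ h u / φ ⬝ᵥ h u) * φ ⬝ᵥ fderiv ℝ h u e)) :=
    (((hdot η).tendsto _).comp hD).sub <|
      ((((hdot η).tendsto _).comp hv).div hφv' hφv).mul (((hdot φ).tendsto _).comp hD)
  rw [hηv, zero_div, zero_mul, sub_zero] at hlim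
  obtain ⟨g, ⟨hg1, hg2, hg3⟩, ω, m, γ, hr⟩ := exists_shearReturns hlat e φ hφe
    ((hu.eventually (H.eventually hX.isOpen)).and <|
      (hφv'.eventually_ne hφv).and (hlim.eventually_ne hne))
  simp only [Function.comp_apply] at hg2
  set v' := h (lact g⁻¹ u) with hv'
  set G := (g : Matrix (Fin n) (Fin n) ℝ) with hG
  have hd : ∀ ξ x : V n, (ξ ᵥ* G) ⬝ᵥ x = ξ ⬝ᵥ lact g x := fun ξ x => (dotProduct_lact ξ x g).symm
  refine hX.false_of_shearReturns hn hlat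
    (θ := η ᵥ* G - (η ⬝ᵥ lact g v' / φ ⬝ᵥ lact g v') • (φ ᵥ* G)) hr hg1.mem hg1.map_mem
    hg1.analyticAt hg1.eventually_eq ?_ ?_ ?_ ?_ ?_ ?_
  · rw [hd, lact_lact_inv, hφu]
  · rw [hd, lact_lact_inv, hφe]
  · rwa [hd]
  · rw [sub_dotProduct, smul_dotProduct, hd, hd, lact_lact_inv, hφe, hηe, smul_zero, sub_zero]
  · rw [sub_dotProduct, smul_dotProduct, hd, hd, smul_eq_mul, div_mul_cancel₀ _ hg2, sub_self]
  · rwa [sub_dotProduct, smul_dotProduct, hd, hd, smul_eq_mul]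

end

section

variable {n : ℕ} {Γ : Subgroup (SLR n)} {M : Type*} [TopologicalSpace M]
  {ρ : Γ → M → M} {ℳ : Set (V n)} {Φ : V n → M}

lemma dense_compl_of_ne_top {p : Submodule ℝ (V n)} (hp : p ≠ ⊤) : Dense (p : Set (V n))ᶜ := by
  rw [← interior_eq_empty_iff_dense_compl]
  by_contra h
  exact hp (p.eq_top_of_nonempty_interior' (nonempty_iff_ne_empty.2 h))

lemma span_pair_ne_top (hn : 3 ≤ n) (u v : V n) : Submodule.span ℝ {u, v} ≠ ⊤ := by
  classical
  intro h
  have h1 := finrank_span_le_card (R := ℝ) ({u, v} : Set (V n))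
  rw [h, finrank_top, Module.finrank_fin_fun] at h1
  have h2 : ({u, v} : Set (V n)).toFinset.card ≤ 2 := by
    simpa using Finset.card_le_two (a := u) (b := v)
  omega

lemma IsDeckGerm.exists_inverse (hX : LinExt Γ ρ ℳ Φ) {h : V n → V n} {u : V n}
    (H : IsDeckGerm ℳ Φ h u) : ∃ h' : V n → V n, IsDeckGerm ℳ Φ h' (h u) ∧ h' (h u) = u ∧
      ∀ᶠ x in 𝓝 u, h' (h x) = x := by
  obtain ⟨h', h1, h2, h3⟩ := hX.germ (h u) H.map_mem u H.mem H.eventually_eq.self_of_nhds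
  refine ⟨h', ⟨h1, H.map_mem, by rw [h2]; exact H.mem, h3⟩, h2, ?_⟩
  obtain ⟨U, hU, hinj⟩ := hX.locInj u H.mem
  have hc : Tendsto (fun x => h' (h x)) (𝓝 u) (𝓝 u) := by
    have := h1.continuousAt.tendsto.comp H.analyticAt.continuousAt.tendsto
    rwa [h2] at this
  filter_upwards [hU, hc hU, H.eventually_eq, H.analyticAt.continuousAt.eventually h3]
    with x hx hx' h4 h5
  exact hinj hx' hx (h5.trans h4)

lemma linearIndependent_pair_notMem {u v : V n} (h : LinearIndependent ℝ ![u, v]) :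
    u ∉ Submodule.span ℝ {v} ∧ v ∉ Submodule.span ℝ {u} := by
  constructor
  · simpa using h.notMem_span_image (s := {1}) (x := 0) (by simp)
  · simpa using h.notMem_span_image (s := {0}) (x := 1) (by simp)

lemma IsDeckGerm.fderiv_mem_span (hX : LinExt Γ ρ ℳ Φ) (hn : 0 < n)
    (hlat : IsLatticeIn (SLR n) Γ) {h : V n → V n} {u e : V n} (H : IsDeckGerm ℳ Φ h u)
    (hvu : h u ∉ Submodule.span ℝ {u}) (he : e ∉ Submodule.span ℝ {h u, u}) :
    fderiv ℝ h u e ∈ Submodule.span ℝ {e, h u} := by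
  by_contra hne
  obtain ⟨η, hη, hη'⟩ := exists_dotProduct_ne_zero_of_notMem hne
  exact hη (H.dotProduct_fderiv_eq_zero hX hn hlat hvu he (hη' _ (Submodule.subset_span (by simp)))
    (hη' _ (Submodule.subset_span (by simp))))

lemma IsDeckGerm.fderiv_eq_smul (hX : LinExt Γ ρ ℳ Φ) (hn : 3 ≤ n)
    (hlat : IsLatticeIn (SLR n) Γ) {h : V n → V n} {u : V n} (H : IsDeckGerm ℳ Φ h u)
    (hind : LinearIndependent ℝ ![u, h u]) :
    ∃ c : ℝ, c ≠ 0 ∧ ∀ e, fderiv ℝ h u e = c • e := by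
  obtain ⟨huv, hvu⟩ := linearIndependent_pair_notMem hind
  obtain ⟨h', H', hh'u, hcomp⟩ := H.exists_inverse hX
  set D := fderiv ℝ h u with hD
  set D' := fderiv ℝ h' (h u) with hD'
  have hDD : ∀ e, D' (D e) = e := by
    have h1 : HasFDerivAt (fun x => h' (h x)) (D'.comp D) u :=
      H'.analyticAt.differentiableAt.hasFDerivAt.comp u H.analyticAt.differentiableAt.hasFDerivAt
    have h2 : HasFDerivAt (fun x => h' (h x)) (ContinuousLinearMap.id ℝ (V n)) u :=
      (hasFDerivAt_id u).congr_of_eventuallyEq hcomp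
    exact fun e => DFunLike.congr_fun (h1.unique h2) e
  have hDinj : Injective D := fun a b hab => by rw [← hDD a, hab, hDD]
  set S := Submodule.span ℝ {h u, u} with hS
  have hStop : S ≠ ⊤ := span_pair_ne_top hn _ _
  have hDStop : S.comap (D : V n →ₗ[ℝ] V n) ≠ ⊤ := by
    intro htop
    refine hStop (eq_top_iff.2 fun x _ => ?_)
    obtain ⟨y, rfl⟩ := LinearMap.surjective_of_injective (f := (D : V n →ₗ[ℝ] V n)) hDinj x
    have : y ∈ S.comap (D : V n →ₗ[ℝ] V n) := htop ▸ Submodule.mem_top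
    exact this
  have hdense : Dense ((S : Set (V n))ᶜ ∩ (S.comap (D : V n →ₗ[ℝ] V n) : Set (V n))ᶜ) :=
    (dense_compl_of_ne_top hStop).inter_of_isOpen_left (dense_compl_of_ne_top hDStop)
      S.closed_of_finiteDimensional.isOpen_compl
  have hclosed : IsClosed {e : V n | ¬ LinearIndependent ℝ ![e, D e]} := by
    have hc : Continuous fun e : V n => (![e, D e] : Fin 2 → V n) := by
      refine continuous_pi fun i => ?_
      fin_cases i
      · exact continuous_id
      · exact D.continuous
    exact (isOpen_setOfPred_linearIndependent.preimage hc).isClosed_compl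
  have hgen : ∀ e, ¬ LinearIndependent ℝ ![e, D e] := by
    intro e
    refine hclosed.closure_subset_iff.2 ?_ (hdense e)
    rintro e ⟨heS, heDS⟩ hli
    have heS' : e ∉ Submodule.span ℝ {h u, u} := heS
    have hDeS : D e ∉ Submodule.span ℝ {h u, u} := heDS
    have h1 := H.fderiv_mem_span hX (by omega) hlat hvu heS'
    have h2 := H'.fderiv_mem_span hX (by omega) hlat (e := D e) (by rwa [hh'u])
      (by rw [hh'u, Set.pair_comm]; exact hDeS)
    rw [← hD', hDD, hh'u] at h2
    rw [← hD] at h1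
    obtain ⟨α, β, h1⟩ := Submodule.mem_span_pair.1 h1
    obtain ⟨a, b, h2⟩ := Submodule.mem_span_pair.1 h2
    by_cases hβ : β = 0
    · rw [hβ, zero_smul, add_zero] at h1
      exact (linearIndependent_pair_notMem hli).2 (Submodule.mem_span_singleton.2 ⟨α, h1⟩)
    · rw [← h1] at h2
      have h3 : (1 - a * α) • e = (a * β) • h u + b • u := by
        rw [sub_smul, one_smul]
        nth_rewrite 1 [← h2]
        module
      have h4 : 1 - a * α = 0 := by
        by_contra h0
        refine heS' (Submodule.mem_span_pair.2 ⟨(1 - a * α)⁻¹ * (a * β), (1 - a * α)⁻¹ * b, ?_⟩)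
        rw [mul_smul _ (a * β), mul_smul _ b, ← smul_add, ← h3, inv_smul_smul₀ h0]
      have ha : a ≠ 0 := by
        rintro rfl
        simp at h4
      rw [h4, zero_smul] at h3
      refine hvu (Submodule.mem_span_singleton.2 ⟨-((a * β)⁻¹ * b), ?_⟩)
      have : (a * β) • h u = -(b • u) := eq_neg_of_add_eq_zero_left h3.symm
      rw [neg_smul, mul_smul, ← smul_neg, ← this, inv_smul_smul₀ (mul_ne_zero ha hβ)]
  obtain ⟨c, hc⟩ := LinearMap.exists_eq_smul_id_of_forall_notLinearIndependent
    (f := (D : V n →ₗ[ℝ] V n)) hgen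
  have hc' : ∀ e, D e = c • e := fun e => DFunLike.congr_fun hc e
  refine ⟨c, ?_, hc'⟩
  rintro rfl
  have hu0 : u = 0 := hDinj (by rw [hc', map_zero, zero_smul])
  exact huv (hu0 ▸ Submodule.zero_mem _)

/-- An analytic map whose derivative is a homothety near `u` is affine near `u`. -/
lemma eventually_eq_smul_add (hn : 2 ≤ n) {h : V n → V n} {u : V n} (hh : AnalyticAt ℝ h u)
    (hD : ∀ᶠ x in 𝓝 u, ∃ c : ℝ, ∀ e, fderiv ℝ h x e = c • e) {c : ℝ}
    (hc : ∀ e, fderiv ℝ h u e = c • e) : ∃ w, ∀ᶠ x in 𝓝 u, h x = c • x + w := by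
  have hn0 : 0 < n := by omega
  let e₀ : V n := Pi.single ⟨0, hn0⟩ 1
  let κ : V n → ℝ := fun x => fderiv ℝ h x e₀ ⟨0, hn0⟩
  obtain ⟨r, hr, hball⟩ := Metric.eventually_nhds_iff_ball.1 (hD.and hh.eventually_analyticAt)
  have hκ : ∀ x ∈ Metric.ball u r, fderiv ℝ h x = κ x • ContinuousLinearMap.id ℝ (V n) := by
    intro x hx
    obtain ⟨c, hc⟩ := (hball x hx).1
    have : κ x = c := by simp [κ, hc, e₀]
    ext1 e
    simp [this, hc]
  have hκd : ∀ x ∈ Metric.ball u r, DifferentiableAt ℝ κ x := by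
    intro x hx
    have h1 : DifferentiableAt ℝ (fun y => fderiv ℝ h y e₀) x :=
      ((hball x hx).2.fderiv.differentiableAt).clm_apply (differentiableAt_const _)
    exact differentiableAt_pi.1 h1 _
  have hκ0 : EqOn (fderiv ℝ κ) 0 (Metric.ball u r) := by
    intro x hx
    have hsymm : IsSymmSndFDerivAt ℝ h x :=
      ((hball x hx).2.contDiffAt (n := 2)).isSymmSndFDerivAt (by simp)
    have h1 : HasFDerivAt (fderiv ℝ h)
        ((fderiv ℝ κ x).smulRight (ContinuousLinearMap.id ℝ (V n))) x := by
      refine HasFDerivAt.congr_of_eventuallyEq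
        ((hκd x hx).hasFDerivAt.smul_const (ContinuousLinearMap.id ℝ (V n))) ?_
      filter_upwards [Metric.isOpen_ball.mem_nhds hx] with y hy using hκ y hy
    have h2 : ∀ a b : V n, fderiv ℝ κ x a • b = fderiv ℝ κ x b • a := by
      intro a b
      have := hsymm.eq a b
      rw [h1.fderiv] at this
      simpa using this
    ext1 a
    by_contra hne
    have hne' : fderiv ℝ κ x a ≠ 0 := hne
    have := finrank_le_one (R := ℝ) a fun b => ⟨(fderiv ℝ κ x a)⁻¹ * fderiv ℝ κ x b, by
      rw [mul_smul, ← h2, inv_smul_smul₀ hne']⟩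
    rw [Module.finrank_fin_fun] at this
    omega
  have hconst : ∀ x ∈ Metric.ball u r, κ x = c := by
    intro x hx
    have h1 := Metric.isOpen_ball.is_const_of_fderiv_eq_zero (𝕜 := ℝ)
      (convex_ball u r).isPreconnected
      (fun y hy => (hκd y hy).differentiableWithinAt) hκ0 hx (Metric.mem_ball_self hr)
    rw [h1]
    simp [κ, hc, e₀]
  refine ⟨h u - c • u, Metric.eventually_nhds_iff_ball.2 ⟨r, hr, fun x hx => ?_⟩⟩
  have hd : ∀ y ∈ Metric.ball u r, HasFDerivAt (fun y => h y - c • y)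
      (fderiv ℝ h y - c • ContinuousLinearMap.id ℝ (V n)) y := fun y hy =>
    (hball y hy).2.differentiableAt.hasFDerivAt.sub ((hasFDerivAt_id y).const_smul c)
  have h1 := Metric.isOpen_ball.is_const_of_fderiv_eq_zero (𝕜 := ℝ)
    (convex_ball u r).isPreconnected (f := fun y => h y - c • y)
    (fun y hy => (hd y hy).differentiableAt.differentiableWithinAt)
    (fun y hy => by rw [(hd y hy).fderiv, hκ y hy, hconst y hy, sub_self]; rfl)
    hx (Metric.mem_ball_self hr)
  rw [← h1]
  abel

end

section

variable {n : ℕ} {Γ : Subgroup (SLR n)} {M : Type*} [TopologicalSpace M]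
  {ρ : Γ → M → M} {ℳ : Set (V n)} {Φ : V n → M}

lemma exists_contracts_inter (hn : 3 ≤ n) (hlat : IsLatticeIn (SLR n) Γ) (x y : V n)
    {U W : Set (V n)} (hU : U ∈ 𝓝 x) (hW : W ∈ 𝓝 y) :
    ∃ ℓ, Contracts Γ ℓ ∧ ∃ x' ∈ U, ∃ y' ∈ W, ℓ ⬝ᵥ x' = 0 ∧ ℓ ⬝ᵥ y' = 0 := by
  obtain ⟨p, hp⟩ : ∃ p, p ∉ Submodule.span ℝ {x, y} := by
    by_contra! h
    exact span_pair_ne_top hn x y (eq_top_iff.2 fun p _ => h p)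
  obtain ⟨ℓ₀, hℓp, hℓ⟩ := exists_dotProduct_ne_zero_of_notMem hp
  have hproj : ∀ z ∈ Submodule.span ℝ {x, y}, ∀ U ∈ 𝓝 z,
      ∀ᶠ ℓ : V n in 𝓝 ℓ₀, z - (ℓ ⬝ᵥ z / ℓ ⬝ᵥ p) • p ∈ U := by
    intro z hz U hU
    have hc : ContinuousAt (fun ℓ : V n => z - (ℓ ⬝ᵥ z / ℓ ⬝ᵥ p) • p) ℓ₀ := by
      have hd : ContinuousAt (fun ℓ : V n => ℓ ⬝ᵥ z / ℓ ⬝ᵥ p) ℓ₀ :=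
        ContinuousAt.div (by fun_prop) (by fun_prop) hℓp
      exact continuousAt_const.sub (hd.smul continuousAt_const)
    refine hc.preimage_mem_nhds ?_
    rwa [hℓ z hz, zero_div, zero_smul, sub_zero]
  have hne : ∀ᶠ ℓ : V n in 𝓝 ℓ₀, ℓ ⬝ᵥ p ≠ 0 :=
    ((show Continuous fun ℓ : V n => ℓ ⬝ᵥ p by fun_prop).tendsto ℓ₀).eventually_ne hℓp
  have hev := (hproj x (Submodule.subset_span (by simp)) U hU).and
    ((hproj y (Submodule.subset_span (by simp)) W hW).and hne)
  obtain ⟨ℓ, ⟨h1, h2, h3⟩, h4⟩ := mem_closure_iff_nhds.1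
    ((dense_contracts (by omega) hlat) ℓ₀) _ hev
  have hzero : ∀ z : V n, ℓ ⬝ᵥ (z - (ℓ ⬝ᵥ z / ℓ ⬝ᵥ p) • p) = 0 := fun z => by
    rw [dotProduct_sub, dotProduct_smul, smul_eq_mul, div_mul_cancel₀ _ h3, sub_self]
  exact ⟨ℓ, h4, _, h1, _, h2, hzero x, hzero y⟩

lemma LinExt.exists_deckGerm (hX : LinExt Γ ρ ℳ Φ) (hn : 3 ≤ n)
    (hlat : IsLatticeIn (SLR n) Γ) (hinj : ¬ InjOn Φ ℳ) :
    ∃ h u, IsDeckGerm ℳ Φ h u ∧ LinearIndependent ℝ ![u, h u] := by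
  have : NeZero n := ⟨by omega⟩
  simp only [InjOn, not_forall] at hinj
  obtain ⟨u, hu, v, hv, huv, hne⟩ := hinj
  obtain ⟨h, hh, rfl, hΦ⟩ := hX.germ u hu v hv huv
  have H : IsDeckGerm ℳ Φ h u := ⟨hh, hu, hv, hΦ⟩
  have hmove : ∀ᶠ x in 𝓝 u, IsDeckGerm ℳ Φ h x ∧ h x ≠ x := by
    refine (H.eventually hX.isOpen).and ?_
    have := (hh.continuousAt.sub continuousAt_id).eventually_ne (sub_ne_zero.2 (Ne.symm hne))
    filter_upwards [this] with x hx using sub_ne_zero.1 hx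
  obtain ⟨x₁, hx₁, hx₁0⟩ := mem_closure_iff_nhds.1 (dense_compl_singleton (0 : V n) u) _
    hmove.eventually_nhds
  have hx₁0 : x₁ ≠ 0 := hx₁0
  have hx₁' : ∀ᶠ x in 𝓝 x₁, (IsDeckGerm ℳ Φ h x ∧ h x ≠ x) ∧ x ≠ 0 :=
    Eventually.and hx₁ (isOpen_ne.mem_nhds hx₁0)
  obtain ⟨ℓ, hℓ, x, ⟨⟨Hx, hxne⟩, hx0⟩, -, -, hℓx, -⟩ :=
    exists_contracts_inter hn hlat x₁ x₁ hx₁' univ_mem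
  refine ⟨h, x, Hx, (LinearIndependent.pair_iff' hx0).2 fun t ht => hxne ?_⟩
  refine hX.injOn_of_contracts hℓ ?_ hℓx Hx.eventually_eq.self_of_nhds
  rw [← ht, dotProduct_smul, hℓx, smul_zero]

lemma LinExt.exists_affine_deckGerm (hX : LinExt Γ ρ ℳ Φ) (hn : 3 ≤ n)
    (hlat : IsLatticeIn (SLR n) Γ) (hinj : ¬ InjOn Φ ℳ) :
    ∃ (c : ℝ) (u w : V n), c ≠ 0 ∧ u ≠ 0 ∧ w ∉ Submodule.span ℝ {u} ∧
      ∀ᶠ x in 𝓝 u, x ∈ ℳ ∧ c • x + w ∈ ℳ ∧ Φ (c • x + w) = Φ x := by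
  obtain ⟨h, u, H, hind⟩ := hX.exists_deckGerm hn hlat hinj
  obtain ⟨c, hc, hD⟩ := H.fderiv_eq_smul hX hn hlat hind
  have hpair : ContinuousAt (fun x => (![x, h x] : Fin 2 → V n)) u := by
    refine continuousAt_pi.2 fun i => ?_
    fin_cases i
    · exact continuousAt_id
    · exact H.analyticAt.continuousAt
  have hev : ∀ᶠ x in 𝓝 u, ∃ c : ℝ, ∀ e, fderiv ℝ h x e = c • e := by
    filter_upwards [H.eventually hX.isOpen,
      hpair.eventually (isOpen_setOfPred_linearIndependent.mem_nhds hind)] with x hx hx'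
    obtain ⟨c, -, hc⟩ := hx.fderiv_eq_smul hX hn hlat hx'
    exact ⟨c, hc⟩
  obtain ⟨w, hw⟩ := eventually_eq_smul_add (by omega) H.analyticAt hev hD
  refine ⟨c, u, w, hc, by simpa using hind.ne_zero 0, fun hmem => ?_, ?_⟩
  · refine (linearIndependent_pair_notMem hind).2 ?_
    rw [hw.self_of_nhds]
    exact Submodule.add_mem _ (Submodule.smul_mem _ _ (Submodule.mem_span_singleton_self u)) hmem
  · filter_upwards [hw, H.eventually hX.isOpen] with x hx Hx
    rw [← hx]
    exact ⟨Hx.mem, Hx.map_mem, Hx.eventually_eq.self_of_nhds⟩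

lemma LinExt.exists_translation (hX : LinExt Γ ρ ℳ Φ) (hn : 3 ≤ n)
    (hlat : IsLatticeIn (SLR n) Γ) (hinj : ¬ InjOn Φ ℳ) :
    ∃ τ : V n, τ ≠ 0 ∧ ∃ y₀, ∀ᶠ y in 𝓝 y₀, y ∈ ℳ ∧ y + τ ∈ ℳ ∧ Φ (y + τ) = Φ y := by
  obtain ⟨c, u, w, hc, hu0, hwu, hev⟩ := hX.exists_affine_deckGerm hn hlat hinj
  obtain ⟨φ, hφw, hφ⟩ := exists_dotProduct_ne_zero_of_notMem hwu
  have hφu : φ ⬝ᵥ u = 0 := hφ u (Submodule.mem_span_singleton_self u)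
  have hu : Tendsto (fun g : SLR n => lact g⁻¹ u) (𝓝 1) (𝓝 u) := by
    have h1 : Tendsto (fun g : SLR n => g⁻¹) (𝓝 1) (𝓝 1) := by
      simpa using (tendsto_id (x := 𝓝 (1 : SLR n))).inv
    simpa only [lact_one] using tendsto_lact h1 (tendsto_const_nhds (x := u))
  have hw : Tendsto (fun g : SLR n => φ ⬝ᵥ lact g w) (𝓝 1) (𝓝 (φ ⬝ᵥ w)) := by
    have hid : Tendsto (fun g : SLR n => g) (𝓝 1) (𝓝 1) := tendsto_id
    have h1 : Tendsto (fun g : SLR n => lact g w) (𝓝 1) (𝓝 w) := by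
      simpa only [lact_one] using tendsto_lact hid (tendsto_const_nhds (x := w))
    exact ((show Continuous fun x : V n => φ ⬝ᵥ x by fun_prop).tendsto w).comp h1
  obtain ⟨g, ⟨hg, hgw⟩, ω, m, γ, hr⟩ := exists_shearReturns hlat u φ hφu
    ((hu.eventually hev.eventually_nhds).and (hw.eventually_ne hφw))
  set x₀ := lact g⁻¹ u with hx₀
  have hx₀0 : x₀ ≠ 0 := fun h0 => hu0 (by rw [← lact_lact_inv g u, ← hx₀, h0, lact_zero])
  set b := φ ⬝ᵥ lact g w with hb
  have hγx₀ : Tendsto (fun k => lact (γ k) x₀) atTop (𝓝 x₀) := by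
    have h1 : Tendsto (fun k => lact (ω k) x₀) atTop (𝓝 x₀) := by
      simpa only [lact_one] using tendsto_lact hr.error (tendsto_const_nhds (x := x₀))
    refine h1.congr fun k => ?_
    rw [hr.eq, ← dotProduct_lact, lact_lact_inv, hφu, mul_zero, zero_smul, add_zero]
  have hωw : Tendsto (fun k => lact (ω k)⁻¹ w) atTop (𝓝 w) := by
    simpa only [inv_one, lact_one] using
      tendsto_lact hr.error.inv (tendsto_const_nhds (x := w))
  have hm : Tendsto (fun k => (m k : ℝ)) atTop atTop :=
    tendsto_natCast_atTop_atTop.comp hr.exponent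
  have hpos : 0 < |b| * ‖x₀‖ := mul_pos (abs_pos.2 hgw) (norm_pos_iff.2 hx₀0)
  obtain ⟨k, ⟨hk1, hk2⟩, hk3⟩ := (((hγx₀.eventually hg.eventually_nhds).and
    (hωw.eventually (Metric.ball_mem_nhds w one_pos))).and
    (hm.eventually (eventually_gt_atTop (1 / (|b| * ‖x₀‖))))).exists
  rw [div_lt_iff₀ hpos] at hk3
  refine ⟨lact (γ k) w - w, fun h0 => ?_, c • lact (γ k) x₀ + w, ?_⟩
  · have h1 : lact (ω k)⁻¹ w = w + ((m k : ℝ) * b) • x₀ := by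
      have h2 := hr.eq k w
      rw [sub_eq_zero.1 h0, ← dotProduct_lact, ← hb] at h2
      exact lact_injective (ω k) (by rw [lact_lact_inv, ← h2])
    rw [h1, dist_eq_norm, add_sub_cancel_left, norm_smul, norm_mul,
      Real.norm_natCast, Real.norm_eq_abs] at hk2
    linarith
  · have hlim : Tendsto (fun y : V n => lact (γ k)⁻¹ (c⁻¹ • (y - w)))
        (𝓝 (c • lact (γ k) x₀ + w)) (𝓝 x₀) := by
      have : Continuous fun y : V n => lact (γ k)⁻¹ (c⁻¹ • (y - w)) :=
        (continuous_lact_right _).comp (by fun_prop)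
      have h2 := this.tendsto (c • lact (γ k) x₀ + w)
      rwa [add_sub_cancel_right, inv_smul_smul₀ hc, lact_inv_lact] at h2
    have hlim' := ((continuous_lact_right (γ k)).tendsto x₀).comp hlim
    filter_upwards [hlim.eventually hg, hlim'.eventually hk1] with y hy hy'
    simp only [Function.comp_apply, lact_lact_inv] at hy'
    set x := lact (γ k)⁻¹ (c⁻¹ • (y - w)) with hx
    have hcx : lact (γ k) (c • x + w) = y + (lact (γ k) w - w) := by
      rw [lact_add, lact_smul, hx, lact_lact_inv, smul_inv_smul₀ hc]
      abel
    rw [smul_inv_smul₀ hc, sub_add_cancel] at hy'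
    refine ⟨hy'.2.1, hcx ▸ hX.lact_mem _ (hr.mem k) _ hy.2.1, ?_⟩
    rw [← hcx, hX.map_lact_eq (hr.mem k) hy.2.1 hy.1 hy.2.2, hy'.2.2, hx, lact_lact_inv]

end

section

variable {n : ℕ} {Γ : Subgroup (SLR n)} {M : Type*} [TopologicalSpace M]
  {ρ : Γ → M → M} {ℳ : Set (V n)} {Φ : V n → M}

/-- A preconnected open set stays preconnected after intersecting it with a set which is
locally dense and preconnected. -/
lemma isPreconnected_inter_of_ball {X : Type*} [PseudoMetricSpace X] {O D : Set X}
    (hO : IsOpen O) (hOc : IsPreconnected O) (hD : Dense D)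
    (hball : ∀ x, ∀ r > 0, IsPreconnected (Metric.ball x r ∩ D)) : IsPreconnected (O ∩ D) := by
  rw [isPreconnected_iff_subset_of_disjoint] at hOc ⊢
  intro u v hu hv huv hdisj
  have hopen : ∀ w : Set X,
      IsOpen {x | ∃ r > 0, Metric.ball x r ⊆ O ∧ Metric.ball x r ∩ D ⊆ w} := by
    intro w
    refine Metric.isOpen_iff.2 fun x ⟨r, hr, h1, h2⟩ => ⟨r / 2, by positivity, fun y hy => ?_⟩
    have hsub : Metric.ball y (r / 2) ⊆ Metric.ball x r :=
      Metric.ball_subset_ball' (by linarith [Metric.mem_ball.1 hy])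
    exact ⟨r / 2, by positivity, hsub.trans h1, (inter_subset_inter_left _ hsub).trans h2⟩
  have key := hOc _ _ (hopen u) (hopen v) ?_ ?_
  · refine key.imp (fun h x hx => ?_) (fun h x hx => ?_) <;>
    · obtain ⟨r, hr, -, h2⟩ := h hx.1
      exact h2 ⟨Metric.mem_ball_self hr, hx.2⟩
  · intro x hx
    obtain ⟨r, hr, hrO⟩ := Metric.isOpen_iff.1 hO x hx
    have hsub : Metric.ball x r ∩ D ⊆ O ∩ D := inter_subset_inter_left _ hrO
    refine (isPreconnected_iff_subset_of_disjoint.1 (hball x r hr) u v hu hv (hsub.trans huv)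
      (subset_eq_empty (inter_subset_inter_left _ hsub) hdisj)).imp ?_ ?_ <;>
    exact fun h => ⟨r, hr, hrO, h⟩
  · refine eq_empty_of_forall_notMem fun x ⟨hx, ⟨r, hr, h1, h2⟩, s, hs, h3, h4⟩ => ?_
    obtain ⟨y, hy, hyD⟩ := mem_closure_iff_nhds.1 (hD x) _
      (inter_mem (Metric.ball_mem_nhds x hr) (Metric.ball_mem_nhds x hs))
    exact hdisj.subset ⟨⟨h1 hy.1, hyD⟩, h2 ⟨hy.1, hyD⟩, h4 ⟨hy.2, hyD⟩⟩

lemma LinExt.dense (hX : LinExt Γ ρ ℳ Φ) (hn : 3 ≤ n) (hlat : IsLatticeIn (SLR n) Γ) :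
    Dense ℳ := by
  refine fun x => mem_closure_iff_nhds.2 fun U hU => ?_
  obtain ⟨ℓ, hℓ, y, hy, -, -, hy0, -⟩ := exists_contracts_inter hn hlat x x hU hU
  exact ⟨y, hy, hX.mem_of_contracts hℓ hy0⟩

lemma LinExt.isPreconnected_convex_inter (hX : LinExt Γ ρ ℳ Φ) (hn : 3 ≤ n)
    (hlat : IsLatticeIn (SLR n) Γ) {O : Set (V n)} (hO : IsOpen O) (hOc : Convex ℝ O) :
    IsPreconnected (O ∩ ℳ) := by
  refine isPreconnected_of_forall_pair fun x hx y hy => ?_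
  have hopen := hO.inter hX.isOpen
  obtain ⟨r, hr, hrO⟩ := Metric.isOpen_iff.1 hopen x hx
  obtain ⟨s, hs, hsO⟩ := Metric.isOpen_iff.1 hopen y hy
  obtain ⟨ℓ, hℓ, x', hx', y', hy', hx0, hy0⟩ := exists_contracts_inter hn hlat x y
    (Metric.ball_mem_nhds x hr) (Metric.ball_mem_nhds y hs)
  have hseg : segment ℝ x' y' ⊆ O ∩ ℳ := by
    intro z hz
    refine ⟨hOc.segment_subset (hrO hx').1 (hsO hy').1 hz, hX.mem_of_contracts hℓ ?_⟩
    obtain ⟨a, b, -, -, -, rfl⟩ := hz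
    rw [dotProduct_add, dotProduct_smul, dotProduct_smul, hx0, hy0, smul_zero, smul_zero, add_zero]
  refine ⟨Metric.ball x r ∪ segment ℝ x' y' ∪ Metric.ball y s,
    union_subset (union_subset hrO hseg) hsO, Or.inl (Or.inl (Metric.mem_ball_self hr)),
    Or.inr (Metric.mem_ball_self hs), ?_⟩
  refine IsPreconnected.union y' (Or.inr (right_mem_segment ℝ x' y')) hy' ?_
    (convex_ball y s).isPreconnected
  exact IsPreconnected.union x' hx' (left_mem_segment ℝ x' y') (convex_ball x r).isPreconnected
    (convex_segment x' y').isPreconnected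

lemma LinExt.isPreconnected_inter_translate (hX : LinExt Γ ρ ℳ Φ) (hn : 3 ≤ n)
    (hlat : IsLatticeIn (SLR n) Γ) (τ : V n) :
    IsPreconnected (ℳ ∩ {x | x + τ ∈ ℳ}) := by
  have hpre : ∀ O : Set (V n), O ∩ {x | x + τ ∈ ℳ} =
      (fun x => x - τ) '' ((fun x => x - τ) ⁻¹' O ∩ ℳ) := by
    intro O
    ext x
    constructor
    · rintro ⟨h1, h2⟩
      exact ⟨x + τ, ⟨by simpa using h1, h2⟩, by simp⟩
    · rintro ⟨y, ⟨h1, h2⟩, rfl⟩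
      exact ⟨h1, by simpa using h2⟩
  refine isPreconnected_inter_of_ball hX.isOpen ?_ ?_ fun x r hr => ?_
  · simpa using hX.isPreconnected_convex_inter hn hlat isOpen_univ convex_univ
  · exact (hX.dense hn hlat).preimage (Homeomorph.addRight τ).isOpenMap
  · rw [hpre]
    refine IsPreconnected.image ?_ _ (by fun_prop)
    have : (fun x => x - τ) ⁻¹' Metric.ball x r = Metric.ball (x + τ) r := by
      ext y
      simp [dist_eq_norm, sub_sub, add_comm]
    rw [this]
    exact hX.isPreconnected_convex_inter hn hlat Metric.isOpen_ball (convex_ball _ _)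

variable [T2Space M]

lemma LinExt.map_add_eq_of_frequently (hX : LinExt Γ ρ ℳ Φ) {x τ : V n} (hx : x ∈ ℳ)
    (hxτ : x + τ ∈ ℳ) (h : ∃ᶠ z in 𝓝 x, Φ (z + τ) = Φ z) : Φ (x + τ) = Φ x := by
  by_contra hne
  have h1 : ContinuousAt Φ x := hX.continuousOn.continuousAt (hX.mem_nhds hx)
  have h2 : ContinuousAt (fun z => Φ (z + τ)) x :=
    ContinuousAt.comp (f := fun z => z + τ) (g := Φ)
      (hX.continuousOn.continuousAt (hX.mem_nhds hxτ)) (by fun_prop)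
  exact h ((h2.ne_iff_eventually_ne h1).1 hne)

lemma LinExt.map_add_eq_of_isPreconnected (hX : LinExt Γ ρ ℳ Φ) {τ y₀ : V n} {E : Set (V n)}
    (hE : IsPreconnected E) (hEM : ∀ x ∈ E, x ∈ ℳ ∧ x + τ ∈ ℳ) (hy₀ : y₀ ∈ E)
    (h : ∀ᶠ y in 𝓝 y₀, Φ (y + τ) = Φ y) : ∀ x ∈ E, Φ (x + τ) = Φ x := by
  suffices hsub : E ⊆ {y | ∀ᶠ z in 𝓝 y, Φ (z + τ) = Φ z} from
    fun x hx => (hsub hx).self_of_nhds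
  refine hE.subset_of_closure_inter_subset isOpen_setOfPred_eventually_nhds ⟨y₀, hy₀, h⟩ ?_
  rintro x ⟨hxc, hxE⟩
  obtain ⟨hx, hxτ⟩ := hEM x hxE
  have hΦx : Φ (x + τ) = Φ x := by
    refine hX.map_add_eq_of_frequently hx hxτ ?_
    exact (mem_closure_iff_frequently.1 hxc).mono fun z hz =>
      Eventually.self_of_nhds (p := fun z => Φ (z + τ) = Φ z) hz
  obtain ⟨f, hf, hfx, hfΦ⟩ := hX.germ x hx (x + τ) hxτ hΦx.symm
  obtain ⟨U, hU, hinj⟩ := hX.locInj _ hxτ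
  have h1 : ∀ᶠ z in 𝓝 x, f z ∈ U := hf.continuousAt.eventually (by rwa [hfx])
  have h2 : ∀ᶠ z in 𝓝 x, z + τ ∈ U :=
    (show Continuous fun z : V n => z + τ by fun_prop).continuousAt.eventually hU
  obtain ⟨r, hr, hb⟩ := Metric.eventually_nhds_iff_ball.1
    (hf.eventually_analyticAt.and (hfΦ.and (h1.and h2)))
  obtain ⟨y, hyb, hy⟩ := mem_closure_iff_nhds.1 hxc _ (Metric.ball_mem_nhds x hr)
  have hyb' : ∀ᶠ z in 𝓝 y, z ∈ Metric.ball x r := Metric.isOpen_ball.mem_nhds hyb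
  have heq : f =ᶠ[𝓝 y] fun z => z + τ := by
    filter_upwards [hyb', show ∀ᶠ z in 𝓝 y, Φ (z + τ) = Φ z from hy] with z hz hz'
    obtain ⟨-, h3, h4, h5⟩ := hb z hz
    exact hinj h4 h5 (h3.trans hz'.symm)
  have hid := AnalyticOnNhd.eqOn_of_preconnected_of_eventuallyEq
    (f := f) (g := fun z => z + τ) (U := Metric.ball x r) (𝕜 := ℝ) (fun z hz => (hb z hz).1)
    (fun z _ => analyticAt_id.add analyticAt_const) (convex_ball x r).isPreconnected hyb heq
  change ∀ᶠ z in 𝓝 x, Φ (z + τ) = Φ z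
  filter_upwards [Metric.ball_mem_nhds x hr] with z hz
  rw [← (hb z hz).2.1, hid hz]

end

/-- The translations `τ` preserving `Φ`. -/
def IsPeriod {n : ℕ} {M : Type*} (ℳ : Set (V n)) (Φ : V n → M) (τ : V n) : Prop :=
  ∀ x ∈ ℳ, x + τ ∈ ℳ → Φ (x + τ) = Φ x

section

variable {n : ℕ} {Γ : Subgroup (SLR n)} {M : Type*} [TopologicalSpace M]
  {ρ : Γ → M → M} {ℳ : Set (V n)} {Φ : V n → M}

lemma IsPeriod.neg {n : ℕ} {M : Type*} {ℳ : Set (V n)} {Φ : V n → M} {τ : V n}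
    (h : IsPeriod ℳ Φ τ) : IsPeriod ℳ Φ (-τ) := fun x hx hxτ => by
  simpa using (h _ hxτ (by simpa using hx)).symm

lemma IsPeriod.add [T2Space M] (hX : LinExt Γ ρ ℳ Φ) (hd : Dense ℳ) {σ τ : V n}
    (hσ : IsPeriod ℳ Φ σ) (hτ : IsPeriod ℳ Φ τ) : IsPeriod ℳ Φ (σ + τ) := by
  intro x hx hxτ
  refine hX.map_add_eq_of_frequently hx hxτ ?_
  have h1 : ∃ᶠ z in 𝓝 x, z + σ ∈ ℳ :=
    mem_closure_iff_frequently.1 (hd.preimage (Homeomorph.addRight σ).isOpenMap x)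
  have h2 : ∀ᶠ z in 𝓝 x, z + (σ + τ) ∈ ℳ :=
    (show Continuous fun z : V n => z + (σ + τ) by fun_prop).continuousAt.eventually
      (hX.mem_nhds hxτ)
  refine (h1.and_eventually (h2.and (hX.mem_nhds hx))).mono fun z ⟨hz1, hz2, hz⟩ => ?_
  rw [← add_assoc] at hz2 ⊢
  rw [hτ _ hz1 hz2, hσ _ hz hz1]

lemma IsPeriod.lact (hX : LinExt Γ ρ ℳ Φ) {γ : SLR n} (hγ : γ ∈ Γ) {τ : V n}
    (hτ : IsPeriod ℳ Φ τ) : IsPeriod ℳ Φ (lact γ τ) := by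
  intro x hx hxτ
  have hsum : Zeghib.lact γ (Zeghib.lact γ⁻¹ x + τ) = x + Zeghib.lact γ τ := by
    rw [lact_add, lact_lact_inv]
  have h1 : Zeghib.lact γ⁻¹ x ∈ ℳ := hX.lact_mem _ (Γ.inv_mem hγ) _ hx
  have h2 : Zeghib.lact γ⁻¹ x + τ ∈ ℳ := hX.mem_of_lact_mem hγ (hsum ▸ hxτ)
  rw [← hsum, hX.map_lact_eq hγ h2 h1 (hτ _ h1 h2), lact_lact_inv]

lemma LinExt.eventually_eq_zero_of_isPeriod (hX : LinExt Γ ρ ℳ Φ) :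
    ∀ᶠ τ in 𝓝 0, IsPeriod ℳ Φ τ → τ = 0 := by
  obtain ⟨U, hU, hinj⟩ := hX.locInj 0 hX.zero_mem
  filter_upwards [hU, hX.mem_nhds hX.zero_mem] with τ hτ hτM h
  exact hinj hτ (mem_of_mem_nhds hU) (by simpa using h 0 hX.zero_mem (by simpa using hτM))

lemma LinExt.exists_isPeriod [T2Space M] (hX : LinExt Γ ρ ℳ Φ) (hn : 3 ≤ n)
    (hlat : IsLatticeIn (SLR n) Γ) (hinj : ¬ InjOn Φ ℳ) : ∃ τ ≠ 0, IsPeriod ℳ Φ τ := by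
  obtain ⟨τ, hτ, y₀, hy₀⟩ := hX.exists_translation hn hlat hinj
  refine ⟨τ, hτ, fun x hx hxτ => ?_⟩
  exact hX.map_add_eq_of_isPreconnected (hX.isPreconnected_inter_translate hn hlat τ)
    (fun x hx => hx) ⟨hy₀.self_of_nhds.1, hy₀.self_of_nhds.2.1⟩
    (hy₀.mono fun y hy => hy.2.2) x ⟨hx, hxτ⟩

end

lemma measurePreserving_lact {n : ℕ} (A : SLR n) :
    MeasurePreserving (lact A) (volume : Measure (V n)) volume := by
  refine ⟨(continuous_lact_right A).measurable, ?_⟩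
  have h : (A : Matrix (Fin n) (Fin n) ℝ).det ≠ 0 := by simp
  have := Real.map_matrix_volume_pi_eq_smul_volume_pi h
  change Measure.map (toLin' (A : Matrix (Fin n) (Fin n) ℝ)) volume = volume
  simpa using this

section

variable {n : ℕ} {Γ : Subgroup (SLR n)} {M : Type*} [TopologicalSpace M]
  {ρ : Γ → M → M} {ℳ : Set (V n)} {Φ : V n → M}

lemma ShearReturns.tendsto_inv_smul {f φ : V n} {ω : ℕ → SLR n} {m : ℕ → ℕ} {γ : ℕ → SLR n}
    (hr : ShearReturns Γ f φ ω m γ) {x : V n} (hx : φ ⬝ᵥ x ≠ 0) :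
    Tendsto (fun k => ((m k : ℝ) * (φ ⬝ᵥ x))⁻¹ • lact (γ k) x) atTop (𝓝 f) := by
  set b := φ ⬝ᵥ x with hb
  have hm : Tendsto (fun k => ((m k : ℝ) * b)⁻¹) atTop (𝓝 0) := by
    have : Tendsto (fun k => (m k : ℝ)⁻¹ * b⁻¹) atTop (𝓝 (0 * b⁻¹)) :=
      (tendsto_inv_atTop_zero.comp
        (tendsto_natCast_atTop_atTop.comp hr.exponent)).mul_const _
    simpa only [mul_inv, zero_mul] using this
  have hlim : Tendsto (fun k => lact (ω k) (((m k : ℝ) * b)⁻¹ • x + f)) atTop (𝓝 f) := by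
    have : Tendsto (fun k => ((m k : ℝ) * b)⁻¹ • x + f) atTop (𝓝 ((0 : ℝ) • x + f)) :=
      (hm.smul_const x).add_const _
    simpa only [lact_one, zero_smul, zero_add] using tendsto_lact hr.error this
  refine hlim.congr' ?_
  filter_upwards [hr.exponent.eventually (eventually_gt_atTop 0)] with k hk
  have hk0 : (m k : ℝ) * b ≠ 0 := mul_ne_zero (by positivity) hx
  rw [hr.eq, ← hb, ← lact_smul, smul_add, inv_smul_smul₀ hk0]

lemma ShearReturns.tendsto_norm {f φ : V n} {ω : ℕ → SLR n} {m : ℕ → ℕ} {γ : ℕ → SLR n}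
    (hr : ShearReturns Γ f φ ω m γ) (hf : f ≠ 0) {x : V n} (hx : φ ⬝ᵥ x ≠ 0) :
    Tendsto (fun k => ‖lact (γ k) x‖) atTop atTop := by
  have h1 : Tendsto (fun k => (m k : ℝ) * |φ ⬝ᵥ x|) atTop atTop :=
    (tendsto_natCast_atTop_atTop.comp hr.exponent).atTop_mul_const (abs_pos.2 hx)
  refine (h1.atTop_mul_pos (norm_pos_iff.2 hf) (hr.tendsto_inv_smul hx).norm).congr' ?_
  filter_upwards [hr.exponent.eventually (eventually_gt_atTop 0)] with k hk
  have hk0 : (m k : ℝ) * |φ ⬝ᵥ x| ≠ 0 := mul_ne_zero (by positivity) (abs_ne_zero.2 hx)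
  rw [norm_smul, norm_inv, norm_mul, Real.norm_natCast, Real.norm_eq_abs, mul_inv_cancel_left₀ hk0]

lemma span_eq_top_of_lact_mem (hlat : IsLatticeIn (SLR n) Γ) {W : Submodule ℝ (V n)}
    (hW : ∀ γ ∈ Γ, ∀ w ∈ W, lact γ w ∈ W) {w : V n} (hw : w ∈ W) (hw0 : w ≠ 0) : W = ⊤ := by
  by_contra hne
  obtain ⟨f, hf⟩ : ∃ f, f ∉ W := by
    by_contra! h
    exact hne (eq_top_iff.2 fun p _ => h p)
  have hwf : w ∉ Submodule.span ℝ {f} := by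
    intro h
    obtain ⟨c, rfl⟩ := Submodule.mem_span_singleton.1 h
    exact hf ((W.smul_mem_iff fun hc => hw0 (by rw [hc, zero_smul])).1 hw)
  obtain ⟨φ, hφw, hφ⟩ := exists_dotProduct_ne_zero_of_notMem hwf
  have hWc : IsClosed (W : Set (V n)) := W.closed_of_finiteDimensional
  have hid : Tendsto (fun g : SLR n => g) (𝓝 1) (𝓝 1) := tendsto_id
  have h1 : Tendsto (fun g : SLR n => lact g⁻¹ f) (𝓝 1) (𝓝 f) := by
    simpa only [inv_one, lact_one] using tendsto_lact hid.inv (tendsto_const_nhds (x := f))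
  have h2 : Tendsto (fun g : SLR n => φ ⬝ᵥ lact g w) (𝓝 1) (𝓝 (φ ⬝ᵥ w)) := by
    have h1 : Tendsto (fun g : SLR n => lact g w) (𝓝 1) (𝓝 w) := by
      simpa only [lact_one] using tendsto_lact hid (tendsto_const_nhds (x := w))
    exact ((show Continuous fun x : V n => φ ⬝ᵥ x by fun_prop).tendsto w).comp h1
  obtain ⟨g, ⟨hg, hgw⟩, ω, m, γ, hr⟩ := exists_shearReturns hlat f φ
    (hφ f (Submodule.mem_span_singleton_self f))
    ((h1.eventually (hWc.isOpen_compl.mem_nhds hf)).and (h2.eventually_ne hφw))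
  refine hg ?_
  refine hWc.mem_of_tendsto (hr.tendsto_inv_smul (x := w) (by rwa [← dotProduct_lact])) ?_
  exact Eventually.of_forall fun k => W.smul_mem _ (hW _ (hr.mem k) _ hw)

lemma LinExt.exists_zlattice [T2Space M] (hX : LinExt Γ ρ ℳ Φ) (hn : 3 ≤ n)
    (hlat : IsLatticeIn (SLR n) Γ) (hinj : ¬ InjOn Φ ℳ) :
    ∃ (Λ : Submodule ℤ (V n)) (_ : DiscreteTopology Λ),
      IsZLattice ℝ Λ ∧ ∀ τ, τ ∈ Λ ↔ IsPeriod ℳ Φ τ := by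
  let Λ : AddSubgroup (V n) :=
    { carrier := {τ | IsPeriod ℳ Φ τ}
      zero_mem' := fun x _ _ => by rw [add_zero]
      add_mem' := fun h h' => h.add hX (hX.dense hn hlat) h'
      neg_mem' := fun h => h.neg }
  have hdisc : DiscreteTopology Λ.toIntSubmodule := by
    refine discreteTopology_iff_isOpen_singleton_zero.2 ?_
    rw [isOpen_singleton_iff_nhds_eq_pure, ← principal_singleton]
    refine le_antisymm (le_principal_iff.2 ?_) ?_
    · have : ∀ᶠ τ : Λ.toIntSubmodule in 𝓝 0, IsPeriod ℳ Φ τ → (τ : V n) = 0 :=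
        (continuous_subtype_val.tendsto (0 : Λ.toIntSubmodule)).eventually
          hX.eventually_eq_zero_of_isPeriod
      filter_upwards [this] with τ hτ using Subtype.ext (hτ τ.2)
    · rw [principal_singleton]
      exact pure_le_nhds _
  refine ⟨Λ.toIntSubmodule, hdisc, ⟨?_⟩, fun τ => Iff.rfl⟩
  obtain ⟨τ, hτ0, hτ⟩ := hX.exists_isPeriod hn hlat hinj
  refine span_eq_top_of_lact_mem hlat (fun γ hγ w hw => ?_)
    (Submodule.subset_span (show τ ∈ (Λ.toIntSubmodule : Set (V n)) from hτ)) hτ0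
  induction hw using Submodule.span_induction with
  | mem x hx => exact Submodule.subset_span (IsPeriod.lact hX hγ hx)
  | zero => rw [lact_zero]; exact Submodule.zero_mem _
  | add x y _ _ hx hy => rw [lact_add]; exact Submodule.add_mem _ hx hy
  | smul c x _ hx => rw [lact_smul]; exact Submodule.smul_mem _ _ hx

end

section

variable {n : ℕ} {M : Type*} {ℳ : Set (V n)} {Φ : V n → M} {Λ : Submodule ℤ (V n)}

/-- The union of the translates of `ℳ` by `Λ`. -/
def saturation (ℳ : Set (V n)) (Λ : Submodule ℤ (V n)) : Set (V n) :=
  {x | ∃ τ ∈ Λ, x + τ ∈ ℳ}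

open Classical in
/-- The extension of `Φ` to a periodic map. -/
def periodicExt (ℳ : Set (V n)) (Φ : V n → M) (Λ : Submodule ℤ (V n)) (x : V n) : M :=
  if h : ∃ τ ∈ Λ, x + τ ∈ ℳ then Φ (x + h.choose) else Φ 0

lemma periodicExt_eq (hΛ : ∀ τ ∈ Λ, IsPeriod ℳ Φ τ) {x τ : V n} (hτ : τ ∈ Λ) (hx : x + τ ∈ ℳ) :
    periodicExt ℳ Φ Λ x = Φ (x + τ) := by
  have h : ∃ τ ∈ Λ, x + τ ∈ ℳ := ⟨τ, hτ, hx⟩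
  rw [periodicExt, dif_pos h]
  have h1 : x + τ + (h.choose - τ) = x + h.choose := by abel
  rw [← h1]
  exact hΛ _ (Λ.sub_mem h.choose_spec.1 hτ) _ hx (h1 ▸ h.choose_spec.2)

lemma subset_saturation : ℳ ⊆ saturation ℳ Λ := fun x hx => ⟨0, Λ.zero_mem, by rwa [add_zero]⟩

lemma periodicExt_of_mem (hΛ : ∀ τ ∈ Λ, IsPeriod ℳ Φ τ) {x : V n} (hx : x ∈ ℳ) :
    periodicExt ℳ Φ Λ x = Φ x := by
  simpa using periodicExt_eq hΛ Λ.zero_mem (x := x) (by rwa [add_zero])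

lemma isOpen_saturation (h : IsOpen ℳ) : IsOpen (saturation ℳ Λ) := by
  have : saturation ℳ Λ = ⋃ τ ∈ Λ, (fun x => x + τ) ⁻¹' ℳ := by ext; simp [saturation]
  rw [this]
  exact isOpen_biUnion fun τ _ => h.preimage (by fun_prop)

lemma add_mem_saturation {x σ : V n} (hσ : σ ∈ Λ) :
    σ + x ∈ saturation ℳ Λ ↔ x ∈ saturation ℳ Λ := by
  refine ⟨fun ⟨τ, hτ, h⟩ => ⟨σ + τ, Λ.add_mem hσ hτ, ?_⟩,
    fun ⟨τ, hτ, h⟩ => ⟨τ - σ, Λ.sub_mem hτ hσ, ?_⟩⟩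
  · convert h using 1; abel
  · convert h using 1; abel

lemma periodicExt_add (hΛ : ∀ τ ∈ Λ, IsPeriod ℳ Φ τ) {x σ : V n} (hσ : σ ∈ Λ)
    (hx : x ∈ saturation ℳ Λ) : periodicExt ℳ Φ Λ (σ + x) = periodicExt ℳ Φ Λ x := by
  obtain ⟨τ, hτ, h⟩ := hx
  have h1 : σ + x + (τ - σ) = x + τ := by abel
  rw [periodicExt_eq hΛ hτ h, periodicExt_eq hΛ (Λ.sub_mem hτ hσ) (by rwa [h1]), h1]

end

section

variable {n : ℕ} {Γ : Subgroup (SLR n)} {M : Type*} [TopologicalSpace M]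
  {ρ : Γ → M → M} {ℳ : Set (V n)} {Φ : V n → M} {Λ : Submodule ℤ (V n)}

lemma LinExt.continuousOn_periodicExt (hX : LinExt Γ ρ ℳ Φ) (hΛ : ∀ τ ∈ Λ, IsPeriod ℳ Φ τ) :
    ContinuousOn (periodicExt ℳ Φ Λ) (saturation ℳ Λ) := by
  rintro x ⟨τ, hτ, hx⟩
  refine ContinuousAt.continuousWithinAt ?_
  have hc : ContinuousAt (fun z => Φ (z + τ)) x :=
    ContinuousAt.comp (f := fun z => z + τ) (g := Φ)
      (hX.continuousOn.continuousAt (hX.mem_nhds hx)) (by fun_prop)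
  refine hc.congr ?_
  filter_upwards [(show Continuous fun z : V n => z + τ by fun_prop).continuousAt.eventually
    (hX.mem_nhds hx)] with z hz using (periodicExt_eq hΛ hτ hz).symm

lemma LinExt.exists_injOn_periodicExt (hX : LinExt Γ ρ ℳ Φ) (hΛ : ∀ τ ∈ Λ, IsPeriod ℳ Φ τ)
    {x : V n} (hx : x ∈ saturation ℳ Λ) : ∃ U ∈ 𝓝 x, InjOn (periodicExt ℳ Φ Λ) U := by
  obtain ⟨τ, hτ, hx⟩ := hx
  obtain ⟨U, hU, hinj⟩ := hX.locInj _ hx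
  have hc : ContinuousAt (fun z : V n => z + τ) x := by fun_prop
  refine ⟨_, hc.preimage_mem_nhds (inter_mem hU (hX.mem_nhds hx)), fun y hy z hz h => ?_⟩
  rw [periodicExt_eq hΛ hτ hy.2, periodicExt_eq hΛ hτ hz.2] at h
  exact add_right_cancel (hinj hy.1 hz.1 h)

lemma LinExt.lact_mem_saturation (hX : LinExt Γ ρ ℳ Φ) (hΛ : ∀ τ, τ ∈ Λ ↔ IsPeriod ℳ Φ τ)
    {γ : SLR n} (hγ : γ ∈ Γ) {x : V n} (hx : x ∈ saturation ℳ Λ) :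
    lact γ x ∈ saturation ℳ Λ := by
  obtain ⟨τ, hτ, hx⟩ := hx
  exact ⟨lact γ τ, (hΛ _).2 (((hΛ _).1 hτ).lact hX hγ), by
    rw [← lact_add]; exact hX.lact_mem γ hγ _ hx⟩

lemma LinExt.periodicExt_lact (hX : LinExt Γ ρ ℳ Φ) (hΛ : ∀ τ, τ ∈ Λ ↔ IsPeriod ℳ Φ τ)
    (γ : Γ) {x : V n} (hx : x ∈ saturation ℳ Λ) :
    periodicExt ℳ Φ Λ (lact (γ : SLR n) x) = ρ γ (periodicExt ℳ Φ Λ x) := by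
  obtain ⟨τ, hτ, hx⟩ := hx
  have hΛ' : ∀ τ ∈ Λ, IsPeriod ℳ Φ τ := fun τ h => (hΛ τ).1 h
  rw [periodicExt_eq hΛ' hτ hx, ← hX.map_lact γ _ hx,
    periodicExt_eq hΛ' (τ := lact (γ : SLR n) τ) ((hΛ _).2 (((hΛ _).1 hτ).lact hX γ.2)) (by
      rw [← lact_add]; exact hX.lact_mem _ γ.2 _ hx), lact_add]

lemma LinExt.measurable_periodicExt [MeasurableSpace M] [BorelSpace M] (hX : LinExt Γ ρ ℳ Φ)
    (hΛ : ∀ τ ∈ Λ, IsPeriod ℳ Φ τ) : Measurable (periodicExt ℳ Φ Λ) := by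
  classical
  have h : periodicExt ℳ Φ Λ =
      (saturation ℳ Λ).piecewise (periodicExt ℳ Φ Λ) (fun _ => Φ 0) := by
    ext x
    by_cases hx : x ∈ saturation ℳ Λ
    · rw [piecewise_eq_of_mem _ _ _ hx]
    · rw [piecewise_eq_of_notMem _ _ _ hx, periodicExt,
        dif_neg (show ¬ ∃ τ ∈ Λ, x + τ ∈ ℳ from hx)]
  rw [h]
  exact (hX.continuousOn_periodicExt hΛ).measurable_piecewise continuousOn_const
    (isOpen_saturation hX.isOpen).measurableSet

/-- If the linearizing map is not injective, its periods form a lattice, and Lebesgue measure on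
the corresponding torus induces an invariant measure. -/
lemma LinExt.exists_invariant_measure [T2Space M] [MeasurableSpace M] [BorelSpace M]
    (hX : LinExt Γ ρ ℳ Φ) (hn : 3 ≤ n) (hlat : IsLatticeIn (SLR n) Γ) (hinj : ¬ InjOn Φ ℳ)
    (hρ : ∀ γ, Continuous (ρ γ)) :
    ∃ μ : Measure M, IsFiniteMeasure μ ∧ (∀ x : M, μ {x} = 0) ∧
      (∀ γ : Γ, Measure.map (ρ γ) μ = μ) ∧
      (∀ U : Set M, IsOpen U → Φ 0 ∈ U → μ U ≠ 0) := by
  obtain ⟨Λ, hdisc, hzl, hΛ⟩ := hX.exists_zlattice hn hlat hinj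
  have : NeZero n := ⟨by omega⟩
  have hΛ' : ∀ τ ∈ Λ, IsPeriod ℳ Φ τ := fun τ h => (hΛ τ).1 h
  let b := Module.Free.chooseBasis ℤ Λ
  set F := ZSpan.fundamentalDomain (b.ofZLatticeBasis ℝ) with hF
  have hFd : IsAddFundamentalDomain Λ F (volume : Measure (V n)) :=
    ZLattice.isAddFundamentalDomain b volume
  have hFm : MeasurableSet F := ZSpan.fundamentalDomain_measurableSet _
  set N := saturation ℳ Λ with hN
  set Ψ := periodicExt ℳ Φ Λ with hΨ
  have hNo : IsOpen N := isOpen_saturation hX.isOpen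
  have hΨc : ContinuousOn Ψ N := hX.continuousOn_periodicExt hΛ'
  have hΨm : Measurable Ψ := hX.measurable_periodicExt hΛ'
  have hB : ∀ A : Set M, MeasurableSet A → MeasurableSet (N ∩ Ψ ⁻¹' A) := fun A hA =>
    hNo.measurableSet.inter (hΨm hA)
  have hμ : ∀ A : Set M, MeasurableSet A →
      Measure.map Ψ (volume.restrict (N ∩ F)) A = volume (N ∩ Ψ ⁻¹' A ∩ F) := by
    intro A hA
    rw [Measure.map_apply hΨm hA, Measure.restrict_apply (hΨm hA), ← inter_assoc,
      inter_comm (Ψ ⁻¹' A)]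
  have : VAddInvariantMeasure Λ (V n) volume :=
    inferInstanceAs (VAddInvariantMeasure Λ.toAddSubgroup (V n) volume)
  have hBinv : ∀ (A : Set M) (g : Λ), (fun x => g +ᵥ x) ⁻¹' (N ∩ Ψ ⁻¹' A) = N ∩ Ψ ⁻¹' A := by
    intro A g
    ext x
    have h1 : g +ᵥ x = (g : V n) + x := rfl
    simp only [mem_preimage, mem_inter_iff, h1, hN, add_mem_saturation g.2]
    refine and_congr_right fun hx => ?_
    rw [hΨ, periodicExt_add hΛ' g.2 hx]
  refine ⟨Measure.map Ψ (volume.restrict (N ∩ F)), ⟨?_⟩, fun p => ?_, fun γ => ?_,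
    fun U hU h0 h => ?_⟩
  · rw [hμ _ MeasurableSet.univ]
    exact (measure_mono inter_subset_right).trans_lt
      (ZSpan.fundamentalDomain_isBounded _).measure_lt_top
  · rw [hμ _ (measurableSet_singleton p)]
    refine measure_mono_null inter_subset_left (measure_null_of_locally_null _ fun x hx => ?_)
    obtain ⟨U, hU, hUi⟩ := hX.exists_injOn_periodicExt hΛ' hx.1
    refine ⟨_, inter_mem_nhdsWithin _ hU, measure_mono_null (t := {x}) ?_ (measure_singleton x)⟩
    rintro y ⟨hy, hyU⟩
    exact hUi hyU (mem_of_mem_nhds hU) (hy.2.trans hx.2.symm)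
  · refine Measure.ext fun A hA => ?_
    have hA' : MeasurableSet (ρ γ ⁻¹' A) := (hρ γ).measurable hA
    rw [Measure.map_apply (hρ γ).measurable hA, hμ _ hA, hμ _ hA']
    have hpre : N ∩ Ψ ⁻¹' (ρ γ ⁻¹' A) = lact (γ : SLR n) ⁻¹' (N ∩ Ψ ⁻¹' A) := by
      ext x
      simp only [mem_inter_iff, mem_preimage]
      refine ⟨fun ⟨h1, h2⟩ => ⟨hX.lact_mem_saturation hΛ γ.2 h1, ?_⟩, fun ⟨h1, h2⟩ => ?_⟩
      · rwa [hΨ, hX.periodicExt_lact hΛ γ h1]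
      · have h3 : x ∈ N := by
          simpa [lact_inv_lact] using hX.lact_mem_saturation hΛ (Γ.inv_mem γ.2) h1
        exact ⟨h3, by rwa [hΨ, hX.periodicExt_lact hΛ γ h3] at h2⟩
    have hF' : IsAddFundamentalDomain Λ (lact (γ : SLR n) ⁻¹' F) (volume : Measure (V n)) := by
      have hmem : ∀ g ∈ Γ, ∀ τ ∈ Λ, lact g τ ∈ Λ := fun g hg τ hτ =>
        (hΛ _).2 (((hΛ _).1 hτ).lact hX hg)
      refine hFd.preimage_of_equiv (measurePreserving_lact _).quasiMeasurePreserving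
        (e := fun τ => ⟨lact (γ : SLR n)⁻¹ τ, hmem _ (Γ.inv_mem γ.2) _ τ.2⟩) ?_ ?_
      · refine bijective_iff_has_inverse.2
          ⟨fun τ => ⟨lact (γ : SLR n) τ, hmem _ γ.2 _ τ.2⟩, fun τ => ?_, fun τ => ?_⟩
        · exact Subtype.ext (lact_lact_inv _ _)
        · exact Subtype.ext (lact_inv_lact _ _)
      · intro g x
        change lact (γ : SLR n) (lact (γ : SLR n)⁻¹ g + x) = (g : V n) + lact (γ : SLR n) x
        rw [lact_add, lact_lact_inv]
    rw [hFd.measure_set_eq hF' (hB _ hA') (hBinv _), hpre, ← preimage_inter]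
    exact (measurePreserving_lact _).measure_preimage ((hB _ hA).inter hFm).nullMeasurableSet
  · rw [hμ _ hU.measurableSet] at h
    have h1 : volume (N ∩ Ψ ⁻¹' U) = 0 := by
      refine hFd.measure_zero_of_invariant _ (fun g => ?_) h
      rw [← preimage_vadd_neg]
      exact hBinv U (-g)
    have h2 : N ∩ Ψ ⁻¹' U ∈ 𝓝 (0 : V n) := by
      refine (hΨc.isOpen_inter_preimage hNo hU).mem_nhds
        ⟨subset_saturation hX.zero_mem, ?_⟩
      rwa [mem_preimage, hΨ, periodicExt_of_mem hΛ' hX.zero_mem]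
    exact (Measure.measure_pos_of_mem_nhds volume h2).ne' h1

end

section

variable {n : ℕ} {Γ : Subgroup (SLR n)}

lemma measure_dotProduct_ne_zero {f φ : V n} {ω : ℕ → SLR n} {m : ℕ → ℕ} {γ : ℕ → SLR n}
    (hr : ShearReturns Γ f φ ω m γ) (hf : f ≠ 0) (ν : Measure (V n)) [IsFiniteMeasure ν]
    (hν : ∀ γ ∈ Γ, MeasurePreserving (lact γ) ν ν) : ν {x | φ ⬝ᵥ x ≠ 0} = 0 := by
  set E := {x : V n | φ ⬝ᵥ x ≠ 0} with hE
  have hEm : MeasurableSet E :=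
    (isOpen_ne_fun (by fun_prop) continuous_const).measurableSet
  have hball : ∀ R : ℕ, ν (Metric.closedBall 0 R) ≤ ν Eᶜ := by
    intro R
    have hB : MeasurableSet (Metric.closedBall (0 : V n) R) :=
      Metric.isClosed_closedBall.measurableSet
    have hpre : ∀ k, MeasurableSet (lact (γ k) ⁻¹' Metric.closedBall (0 : V n) R) := fun k =>
      (hν _ (hr.mem k)).measurable hB
    have hlim : Tendsto (fun k => ν (E ∩ lact (γ k) ⁻¹' Metric.closedBall 0 R)) atTop
        (𝓝 (ν ∅)) := by
      refine tendsto_measure_of_ae_tendsto_indicator_of_isFiniteMeasure atTop MeasurableSet.empty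
        (fun k => hEm.inter (hpre k)) (Eventually.of_forall fun x => ?_)
      by_cases hx : x ∈ E
      · filter_upwards [(hr.tendsto_norm hf hx).eventually (eventually_gt_atTop (R : ℝ))] with k hk
        simpa using fun _ => hk
      · exact Eventually.of_forall fun k => by simp [hx]
    rw [measure_empty] at hlim
    refine ge_of_tendsto (by simpa using hlim.const_add (ν Eᶜ)) (Eventually.of_forall fun k => ?_)
    rw [← (hν _ (hr.mem k)).measure_preimage hB.nullMeasurableSet]
    refine (measure_mono fun x hx => ?_).trans (measure_union_le _ _)
    by_cases hxE : x ∈ E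
    · exact Or.inr ⟨hxE, hx⟩
    · exact Or.inl hxE
  have huniv : ν univ ≤ ν Eᶜ := by
    have hU : (⋃ R : ℕ, Metric.closedBall (0 : V n) R) = univ := Metric.iUnion_closedBall_nat 0
    have hmono : Monotone fun R : ℕ => Metric.closedBall (0 : V n) R := fun a b hab =>
      Metric.closedBall_subset_closedBall (by exact_mod_cast hab)
    rw [← hU, hmono.measure_iUnion]
    exact iSup_le hball
  have h := measure_add_measure_compl (μ := ν) hEm
  have hfin : ν Eᶜ ≠ ⊤ := measure_ne_top ν _
  have h2 : ν E + ν Eᶜ ≤ 0 + ν Eᶜ := by rw [h, zero_add]; exact huniv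
  exact le_antisymm ((ENNReal.add_le_add_iff_right hfin).1 h2) zero_le

/-- A lattice preserves no finite measure on `ℝⁿ` besides the multiples of the Dirac mass at
the origin. -/
lemma measure_compl_singleton_zero (hn : 3 ≤ n) (hlat : IsLatticeIn (SLR n) Γ)
    (ν : Measure (V n)) [IsFiniteMeasure ν]
    (hν : ∀ γ ∈ Γ, MeasurePreserving (lact γ) ν ν) : ν {0}ᶜ = 0 := by
  have hdense : Dense {φ : V n | ν {x | φ ⬝ᵥ x ≠ 0} = 0} := by
    refine fun φ => mem_closure_iff_nhds.2 fun U hU => ?_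
    obtain ⟨p, hp⟩ : ∃ p, p ∉ Submodule.span ℝ {φ, φ} := by
      by_contra! h
      exact span_pair_ne_top hn φ φ (eq_top_iff.2 fun p _ => h p)
    obtain ⟨f, hfp, hf⟩ := exists_dotProduct_ne_zero_of_notMem hp
    have hf0 : f ≠ 0 := fun h => hfp (by rw [h, zero_dotProduct])
    have hφf : φ ⬝ᵥ f = 0 := by
      rw [dotProduct_comm]
      exact hf φ (Submodule.subset_span (by simp))
    have hO : ∀ᶠ g : SLR n in 𝓝 1, φ ᵥ* (g : Matrix (Fin n) (Fin n) ℝ) ∈ U := by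
      refine (continuous_vecMul_coe φ).continuousAt.eventually ?_
      simpa using hU
    obtain ⟨g, hg, ω, m, γ, hr⟩ := exists_shearReturns hlat f φ hφf hO
    refine ⟨_, hg, measure_dotProduct_ne_zero hr (fun h => hf0 ?_) ν hν⟩
    rw [← lact_lact_inv g f, h, lact_zero]
  obtain ⟨s, hs, hsc, hsd⟩ := hdense.exists_countable_dense_subset
  refine measure_mono_null (fun x hx => ?_)
    ((measure_biUnion_null_iff hsc).2 fun φ hφ => hs hφ)
  by_contra hcon
  simp only [mem_iUnion, not_exists, Set.mem_ofPred_eq, not_not] at hcon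
  refine hx (dotProduct_self_eq_zero.1 ?_)
  have hclosed : IsClosed {φ : V n | φ ⬝ᵥ x = 0} := isClosed_eq (by fun_prop) continuous_const
  exact hclosed.closure_subset_iff.2 (fun φ hφ => hcon φ hφ) (hsd x)

end

section

variable {n : ℕ} {Γ : Subgroup (SLR n)} {M : Type*} [TopologicalSpace M]
  {ℳ : Set (V n)} {Φ : V n → M}

lemma LinExt.isOpen_image {ρ : Γ → M → M} (hX : LinExt Γ ρ ℳ Φ) {O : Set (V n)} (hO : IsOpen O)
    (h : O ⊆ ℳ) : IsOpen (Φ '' O) := by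
  refine isOpen_iff_mem_nhds.2 ?_
  rintro _ ⟨x, hx, rfl⟩
  exact hX.image_mem_nhds x (h hx) O (hO.mem_nhds hx)

/-- When `Φ` is injective there is no invariant finite measure without mass at `Φ 0` whose
support contains `Φ 0`. -/
lemma LinExt.not_injOn_of_measure [MeasurableSpace M] [BorelSpace M] [T2Space M]
    {ρ : Γ →* Equiv.Perm M} (hX : LinExt Γ (fun γ => ρ γ) ℳ Φ) (hn : 3 ≤ n)
    (hlat : IsLatticeIn (SLR n) Γ) (hρ : ∀ γ, Continuous (ρ γ)) {μ : Measure M}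
    [IsFiniteMeasure μ] (h0 : μ {Φ 0} = 0) (hμ : ∀ γ : Γ, Measure.map (ρ γ) μ = μ)
    (hsupp : ∀ U : Set M, IsOpen U → Φ 0 ∈ U → μ U ≠ 0) : ¬ InjOn Φ ℳ := by
  classical
  intro hinj
  set N := Φ '' ℳ with hN
  have hNo : IsOpen N := hX.isOpen_image hX.isOpen Subset.rfl
  let Ψ : M → V n := N.piecewise (invFunOn Φ ℳ) (fun _ => 0)
  have hΨ : ∀ x ∈ ℳ, Ψ (Φ x) = x := fun x hx => by
    rw [show Ψ (Φ x) = invFunOn Φ ℳ (Φ x) from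
      piecewise_eq_of_mem _ _ _ (mem_image_of_mem Φ hx)]
    exact hinj.leftInvOn_invFunOn hx
  have hc : ContinuousOn (invFunOn Φ ℳ) N := by
    rintro _ ⟨x, hx, rfl⟩
    refine ContinuousAt.continuousWithinAt fun U hU => ?_
    rw [hinj.leftInvOn_invFunOn hx] at hU
    refine mem_map.2 (mem_of_superset (hX.image_mem_nhds x hx _ (inter_mem hU (hX.mem_nhds hx))) ?_)
    rintro _ ⟨y, hy, rfl⟩
    rw [mem_preimage, hinj.leftInvOn_invFunOn hy.2]
    exact hy.1
  have hΨm : Measurable Ψ := hc.measurable_piecewise continuousOn_const hNo.measurableSet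
  let ν : Measure (V n) := Measure.map Ψ (μ.restrict N)
  have hν : ∀ A, MeasurableSet A → ν A = μ (Φ '' (A ∩ ℳ)) := by
    intro A hA
    rw [Measure.map_apply hΨm hA, Measure.restrict_apply (hΨm hA)]
    congr 1
    ext p
    constructor
    · rintro ⟨hp, x, hx, rfl⟩
      rw [mem_preimage, hΨ x hx] at hp
      exact ⟨x, ⟨hp, hx⟩, rfl⟩
    · rintro ⟨x, ⟨hp, hx⟩, rfl⟩
      exact ⟨by rwa [mem_preimage, hΨ x hx], x, hx, rfl⟩
  have hNm : ∀ A, MeasurableSet A → MeasurableSet (Φ '' (A ∩ ℳ)) := by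
    intro A hA
    have : Φ '' (A ∩ ℳ) = Ψ ⁻¹' A ∩ N := by
      ext p
      constructor
      · rintro ⟨x, ⟨hp, hx⟩, rfl⟩
        exact ⟨by rwa [mem_preimage, hΨ x hx], x, hx, rfl⟩
      · rintro ⟨hp, x, hx, rfl⟩
        rw [mem_preimage, hΨ x hx] at hp
        exact ⟨x, ⟨hp, hx⟩, rfl⟩
    rw [this]
    exact (hΨm hA).inter hNo.measurableSet
  have hpres : ∀ γ ∈ Γ, MeasurePreserving (lact γ) ν ν := by
    intro γ hγ
    refine ⟨(continuous_lact_right γ).measurable, Measure.ext fun A hA => ?_⟩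
    have hA' : MeasurableSet (lact γ ⁻¹' A) := (continuous_lact_right γ).measurable hA
    rw [Measure.map_apply (continuous_lact_right γ).measurable hA, hν _ hA, hν _ hA',
      ← hμ ⟨γ, hγ⟩, Measure.map_apply (hρ _).measurable (hNm _ hA), hμ ⟨γ, hγ⟩]
    congr 1
    ext p
    constructor
    · rintro ⟨x, ⟨hxA, hx⟩, rfl⟩
      exact ⟨lact γ x, ⟨hxA, hX.lact_mem γ hγ x hx⟩, hX.map_lact ⟨γ, hγ⟩ x hx⟩
    · rintro ⟨y, ⟨hyA, hy⟩, hyp⟩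
      refine ⟨lact γ⁻¹ y, ⟨by rwa [mem_preimage, lact_lact_inv],
        hX.lact_mem _ (Γ.inv_mem hγ) y hy⟩, (ρ ⟨γ, hγ⟩).injective ?_⟩
      have hm : lact γ⁻¹ y ∈ ℳ := hX.lact_mem _ (Γ.inv_mem hγ) y hy
      rw [← hyp, ← hX.map_lact ⟨γ, hγ⟩ _ hm, lact_lact_inv]
  have h1 : ν {0}ᶜ = 0 := measure_compl_singleton_zero hn hlat ν hpres
  have h2 : ν {0} = 0 := by
    rw [hν _ (measurableSet_singleton 0)]
    refine measure_mono_null ?_ h0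
    rintro _ ⟨x, ⟨rfl, -⟩, rfl⟩
    rfl
  refine hsupp N hNo (mem_image_of_mem Φ hX.zero_mem) ?_
  have h3 : ν univ = 0 := by
    rw [← union_compl_self {(0 : V n)}]
    exact measure_union_null h2 h1
  rwa [hν _ MeasurableSet.univ, univ_inter] at h3

end

section

variable {n : ℕ}

/-- Every orbit of a neighborhood under `A` comes back to it at arbitrarily large times. -/
def Recurs (A : SLR n) : Prop :=
  ∀ x : V n, ∀ U ∈ 𝓝 x, ∀ N : ℕ, ∃ k ≥ N, ∃ y ∈ U, lact (A ^ k) y ∈ U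

/-- The transpose of `A` over the complex numbers. -/
def ctrans (A : SLR n) : Module.End ℂ (Fin n → ℂ) :=
  Matrix.toLin' (((A : Matrix (Fin n) (Fin n) ℝ).map Complex.ofReal)ᵀ)

/-- Pairing of a complex covector with a real vector. -/
def cpair (ℓ : Fin n → ℂ) (x : V n) : ℂ := ∑ i, ℓ i * (x i : ℂ)

lemma continuous_cpair (ℓ : Fin n → ℂ) : Continuous (cpair ℓ) := by
  unfold cpair
  fun_prop

lemma cpair_ctrans (A : SLR n) (ℓ : Fin n → ℂ) (x : V n) :
    cpair (ctrans A ℓ) x = cpair ℓ (lact A x) := by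
  simp only [cpair, ctrans, toLin'_apply, lact, mulVec, dotProduct, transpose_apply, map_apply,
    Finset.sum_mul, Finset.mul_sum, Complex.ofReal_sum, Complex.ofReal_mul]
  rw [Finset.sum_comm]
  exact Finset.sum_congr rfl fun i _ => Finset.sum_congr rfl fun j _ => by ring

lemma cpair_ctrans_pow (A : SLR n) (k : ℕ) (ℓ : Fin n → ℂ) (x : V n) :
    cpair ((ctrans A ^ k) ℓ) x = cpair ℓ (lact (A ^ k) x) := by
  induction k generalizing x with
  | zero => simp [lact_one]
  | succ k ih => rw [pow_succ', Module.End.mul_apply, cpair_ctrans, ih, pow_succ, lact_mul]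

lemma cpair_smul (c : ℂ) (ℓ : Fin n → ℂ) (x : V n) : cpair (c • ℓ) x = c * cpair ℓ x := by
  simp [cpair, Finset.mul_sum, mul_assoc]

lemma cpair_add (ℓ ℓ' : Fin n → ℂ) (x : V n) : cpair (ℓ + ℓ') x = cpair ℓ x + cpair ℓ' x := by
  simp [cpair, add_mul, Finset.sum_add_distrib]

lemma cpair_single (ℓ : Fin n → ℂ) (i : Fin n) : cpair ℓ (Pi.single i 1) = ℓ i := by
  rw [cpair, Finset.sum_eq_single i] <;> simp +contextual

/-- A quantitative consequence of recurrence for a covector not vanishing at some point. -/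
lemma Recurs.exists_near {A : SLR n} (hA : Recurs A) {ℓ : Fin n → ℂ} (hℓ : ℓ ≠ 0)
    (ℓ' : Fin n → ℂ) : ∃ c > 0, ∃ C, ∀ N : ℕ, ∃ k ≥ N, ∃ y : V n,
      (c ≤ ‖cpair ℓ y‖ ∧ ‖cpair ℓ y‖ ≤ 2 * c) ∧
      (c ≤ ‖cpair ℓ (lact (A ^ k) y)‖ ∧ ‖cpair ℓ (lact (A ^ k) y)‖ ≤ 2 * c) ∧
      ‖cpair ℓ' y‖ ≤ C ∧ ‖cpair ℓ' (lact (A ^ k) y)‖ ≤ C := by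
  obtain ⟨i, hi⟩ := Function.ne_iff.1 hℓ
  set x : V n := Pi.single i 1 with hx
  have hpos : 0 < ‖cpair ℓ x‖ := by
    rw [hx, cpair_single]
    exact norm_pos_iff.2 hi
  have h1 : ∀ᶠ y in 𝓝 x, 2 / 3 * ‖cpair ℓ x‖ < ‖cpair ℓ y‖ :=
    (continuous_cpair ℓ).norm.continuousAt.eventually (eventually_gt_nhds (by linarith))
  have h2 : ∀ᶠ y in 𝓝 x, ‖cpair ℓ y‖ < 4 / 3 * ‖cpair ℓ x‖ :=
    (continuous_cpair ℓ).norm.continuousAt.eventually (eventually_lt_nhds (by linarith))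
  have h3 : ∀ᶠ y in 𝓝 x, ‖cpair ℓ' y‖ < ‖cpair ℓ' x‖ + 1 :=
    (continuous_cpair ℓ').norm.continuousAt.eventually (eventually_lt_nhds (by linarith))
  refine ⟨2 / 3 * ‖cpair ℓ x‖, by positivity, ‖cpair ℓ' x‖ + 1, fun N => ?_⟩
  obtain ⟨k, hk, y, ⟨hy1, hy2, hy3⟩, hz1, hz2, hz3⟩ := hA x _ (h1.and (h2.and h3)) N
  exact ⟨k, hk, y, ⟨hy1.le, by linarith⟩, ⟨hz1.le, by linarith⟩, hy3.le, hz3.le⟩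

lemma Recurs.norm_eq_one {A : SLR n} (hA : Recurs A) {ℓ : Fin n → ℂ} (hℓ : ℓ ≠ 0) {μ : ℂ}
    (h : ctrans A ℓ = μ • ℓ) : ‖μ‖ = 1 := by
  have hpow : ∀ k : ℕ, (ctrans A ^ k) ℓ = μ ^ k • ℓ := fun k => by
    induction k with
    | zero => simp
    | succ k ih => rw [pow_succ', Module.End.mul_apply, ih, map_smul, h, smul_smul, pow_succ]
  obtain ⟨c, hc, C, hC⟩ := hA.exists_near hℓ 0
  have key : ∀ N : ℕ, ∃ k ≥ N, ‖μ‖ ^ k ≤ 2 ∧ 1 / 2 ≤ ‖μ‖ ^ k := by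
    intro N
    obtain ⟨k, hk, y, ⟨h1, h2⟩, ⟨h3, h4⟩, -⟩ := hC N
    rw [← cpair_ctrans_pow, hpow, cpair_smul, norm_mul, norm_pow] at h3 h4
    refine ⟨k, hk, ?_, ?_⟩
    · by_contra! hlt
      nlinarith [mul_le_mul_of_nonneg_left h1 (by positivity : 0 ≤ ‖μ‖ ^ k)]
    · by_contra! hlt
      nlinarith [mul_le_mul_of_nonneg_left h2 (by positivity : 0 ≤ ‖μ‖ ^ k)]
  rcases lt_trichotomy ‖μ‖ 1 with hlt | heq | hgt
  · obtain ⟨N, hN⟩ := ((tendsto_pow_atTop_nhds_zero_of_lt_one (norm_nonneg μ) hlt).eventually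
      (eventually_lt_nhds (by norm_num : (0 : ℝ) < 1 / 2))).exists_forall_of_atTop
    obtain ⟨k, hk, -, h2⟩ := key N
    exact absurd (hN k hk) h2.not_gt
  · exact heq
  · obtain ⟨N, hN⟩ := ((tendsto_pow_atTop_atTop_of_one_lt hgt).eventually
      (eventually_gt_atTop 2)).exists_forall_of_atTop
    obtain ⟨k, hk, h1, -⟩ := key N
    exact absurd (hN k hk) h1.not_gt

lemma Recurs.eigenvector_of_sq {A : SLR n} (hA : Recurs A) {ℓ : Fin n → ℂ} {μ : ℂ}
    (h : (ctrans A - μ • 1) ((ctrans A - μ • 1) ℓ) = 0) : (ctrans A - μ • 1) ℓ = 0 := by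
  by_contra hne
  set ℓ₁ := (ctrans A - μ • 1) ℓ with hℓ₁
  have e1 : ctrans A ℓ₁ = μ • ℓ₁ := by
    simpa [sub_eq_zero] using h
  have e2 : ctrans A ℓ = μ • ℓ + ℓ₁ := by
    rw [hℓ₁]; simp
  have hμ := hA.norm_eq_one hne e1
  have hμ0 : μ ≠ 0 := norm_ne_zero_iff.1 (by rw [hμ]; exact one_ne_zero)
  have hpow : ∀ k : ℕ, (ctrans A ^ k) ℓ = μ ^ k • ℓ + (k * μ ^ k * μ⁻¹) • ℓ₁ := fun k => by
    induction k with
    | zero => simp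
    | succ k ih =>
      rw [pow_succ', Module.End.mul_apply, ih, map_add, map_smul, map_smul, e1, e2]
      push_cast
      have h1 : ((k : ℂ) + 1) * μ ^ (k + 1) * μ⁻¹ = μ ^ k + k * μ ^ k * μ⁻¹ * μ := by
        field_simp
        ring
      rw [h1, pow_succ, add_smul, smul_add, smul_smul, smul_smul]
      abel
  obtain ⟨c, hc, C, hC⟩ := hA.exists_near hne ℓ
  obtain ⟨N, hN⟩ := exists_nat_gt (2 * C / c)
  obtain ⟨k, hk, y, ⟨h1, -⟩, -, h2, h3⟩ := hC N
  rw [← cpair_ctrans_pow, hpow, cpair_add, cpair_smul, cpair_smul] at h3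
  have h4 : ‖(k * μ ^ k * μ⁻¹) * cpair ℓ₁ y‖ = k * ‖cpair ℓ₁ y‖ := by
    simp [hμ]
  have h5 : ‖μ ^ k * cpair ℓ y‖ = ‖cpair ℓ y‖ := by simp [hμ]
  have h6 := norm_sub_le (μ ^ k * cpair ℓ y + (k * μ ^ k * μ⁻¹) * cpair ℓ₁ y) (μ ^ k * cpair ℓ y)
  rw [add_sub_cancel_left, h4, h5] at h6
  rw [div_lt_iff₀ hc] at hN
  have h7 : (N : ℝ) * c ≤ k * ‖cpair ℓ₁ y‖ :=
    mul_le_mul (by exact_mod_cast hk) h1 hc.le (by positivity)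
  linarith

lemma Recurs.exists_bound {A : SLR n} (hA : Recurs A) (ℓ : Fin n → ℂ) :
    ∃ C, ∀ k, ‖(ctrans A ^ k) ℓ‖ ≤ C := by
  let S : Submodule ℂ (Fin n → ℂ) :=
    { carrier := {ℓ | ∃ C, ∀ k, ‖(ctrans A ^ k) ℓ‖ ≤ C}
      zero_mem' := ⟨0, fun k => by simp⟩
      add_mem' := by
        rintro a b ⟨C, hC⟩ ⟨D, hD⟩
        refine ⟨C + D, fun k => ?_⟩
        rw [map_add]
        exact (norm_add_le _ _).trans (add_le_add (hC k) (hD k))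
      smul_mem' := by
        rintro c a ⟨C, hC⟩
        refine ⟨‖c‖ * C, fun k => ?_⟩
        rw [map_smul, norm_smul]
        exact mul_le_mul_of_nonneg_left (hC k) (norm_nonneg c) }
  suffices hS : S = ⊤ from (hS ▸ Submodule.mem_top : ℓ ∈ S)
  rw [eq_top_iff, ← Module.End.iSup_maxGenEigenspace_eq_top (ctrans A), iSup_le_iff]
  intro μ ℓ hℓ
  obtain ⟨k, hk⟩ := (Module.End.mem_maxGenEigenspace _ _ _).1 hℓ
  have h1 : ∀ k : ℕ, ((ctrans A - μ • 1) ^ k) ℓ = 0 → (ctrans A - μ • 1) ℓ = 0 := by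
    intro k
    induction k with
    | zero => intro h; rw [pow_zero, Module.End.one_apply] at h; rw [h, map_zero]
    | succ k ih =>
      rcases k with _ | k
      · simp
      · intro h
        refine ih ?_
        rw [pow_succ', Module.End.mul_apply]
        refine hA.eigenvector_of_sq ?_
        rw [← Module.End.mul_apply, ← Module.End.mul_apply, mul_assoc, ← pow_succ', ← pow_succ']
        exact h
  have h2 : ctrans A ℓ = μ • ℓ := by simpa [sub_eq_zero] using h1 k hk
  rcases eq_or_ne ℓ 0 with rfl | hne
  · exact S.zero_mem
  have hμ := hA.norm_eq_one hne h2
  refine ⟨‖ℓ‖, fun k => ?_⟩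
  have hpow : (ctrans A ^ k) ℓ = μ ^ k • ℓ := by
    induction k with
    | zero => simp
    | succ k ih => rw [pow_succ', Module.End.mul_apply, ih, map_smul, h2, smul_smul, pow_succ]
  rw [hpow, norm_smul, norm_pow, hμ, one_pow, one_mul]

lemma Recurs.exists_entry_bound {A : SLR n} (hA : Recurs A) :
    ∃ C : ℝ, ∀ (k : ℕ) (i j : Fin n), |((A ^ k : SLR n) : Matrix (Fin n) (Fin n) ℝ) i j| ≤ C := by
  choose C hC using fun i : Fin n => hA.exists_bound (Pi.single i (1 : ℂ))
  refine ⟨∑ i, |C i|, fun k i j => ?_⟩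
  have h1 : (((A ^ k : SLR n) : Matrix (Fin n) (Fin n) ℝ) i j : ℂ) =
      (ctrans A ^ k) (Pi.single i (1 : ℂ)) j := by
    rw [← cpair_single ((ctrans A ^ k) _), cpair_ctrans_pow]
    simp [cpair, lact, Pi.single_apply]
  rw [← Real.norm_eq_abs, ← Complex.norm_real, h1]
  calc ‖(ctrans A ^ k) (Pi.single i (1 : ℂ)) j‖ ≤ ‖(ctrans A ^ k) (Pi.single i (1 : ℂ))‖ :=
        norm_le_pi_norm _ j
    _ ≤ C i := hC i k
    _ ≤ |C i| := le_abs_self _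
    _ ≤ ∑ i, |C i| := Finset.single_le_sum (f := fun i => |C i|) (fun i _ => abs_nonneg _)
        (Finset.mem_univ i)

/-- A recurrent element of a discrete subgroup has finite order. -/
lemma Recurs.isOfFinOrder {Γ : Subgroup (SLR n)} [DiscreteTopology Γ] {γ : Γ}
    (hA : Recurs (γ : SLR n)) : IsOfFinOrder γ := by
  obtain ⟨C, hC⟩ := hA.exists_entry_bound
  have hcomp : IsCompact (Set.pi univ fun _ : Fin n => Set.pi univ fun _ : Fin n => Icc (-C) C) :=
    isCompact_univ_pi fun _ => isCompact_univ_pi fun _ => isCompact_Icc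
  let a : ℕ → Fin n → Fin n → ℝ := fun k => (((γ : SLR n) ^ k : SLR n) : Matrix (Fin n) (Fin n) ℝ)
  obtain ⟨L, -, s, hs, hlim⟩ := hcomp.tendsto_subseq (x := a) fun k i _ j _ => abs_le.1 (hC k i j)
  have hlim' : Tendsto (fun k => (((γ : SLR n) ^ s k : SLR n) : Matrix (Fin n) (Fin n) ℝ)) atTop
      (𝓝 (Matrix.of L)) := hlim
  have hdet : (Matrix.of L).det = 1 := by
    have h1 := ((continuous_id (X := Matrix (Fin n) (Fin n) ℝ)).matrix_det.tendsto _).comp hlim'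
    refine tendsto_nhds_unique h1 (tendsto_const_nhds.congr fun k => ?_)
    exact (Matrix.SpecialLinearGroup.det_coe ((γ : SLR n) ^ s k)).symm
  let g : SLR n := ⟨Matrix.of L, hdet⟩
  have hg : Tendsto (fun k => (γ : SLR n) ^ s k) atTop (𝓝 g) := by
    rw [nhds_induced, tendsto_comap_iff]
    exact hlim'
  have h1 : Tendsto (fun k => (γ : SLR n) ^ s (k + 1) * ((γ : SLR n) ^ s k)⁻¹) atTop (𝓝 1) := by
    simpa using (hg.comp (tendsto_add_atTop_nat 1)).mul hg.inv
  obtain ⟨U, hU, hUe⟩ := isOpen_induced_iff.1 (isOpen_discrete ({1} : Set Γ))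
  have h1U : (1 : SLR n) ∈ U := by
    have : (1 : Γ) ∈ Subtype.val ⁻¹' U := by rw [hUe]; rfl
    exact this
  obtain ⟨k, hk⟩ := (h1.eventually (hU.mem_nhds h1U)).exists
  have hk' : γ ^ s (k + 1) * (γ ^ s k)⁻¹ ∈ (Subtype.val ⁻¹' U : Set Γ) := hk
  rw [hUe, mem_singleton_iff, mul_inv_eq_one] at hk'
  exact isOfFinOrder_iff_pow_eq_one.2 ⟨s (k + 1) - s k, Nat.sub_pos_of_lt (hs k.lt_succ_self), by
    rw [pow_sub γ (hs k.lt_succ_self).le, hk', mul_inv_cancel]⟩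

end

section

variable {n : ℕ} {Γ : Subgroup (SLR n)} {M : Type*} [TopologicalSpace M]
  {ℳ : Set (V n)} {Φ : V n → M}

lemma LinExt.recurs_of_nonWandering {ρ : Γ →* Equiv.Perm M}
    (hX : LinExt Γ (fun γ => ρ γ) ℳ Φ) (hinj : InjOn Φ ℳ) {γ : Γ} {W : Set M}
    (hW : W ∈ 𝓝 (Φ 0)) (hNW : ∀ x ∈ W, NonWanderingPt (ρ γ) x) : Recurs (γ : SLR n) := by
  have hpow : ∀ (k : ℕ) (x), x ∈ ℳ →
      lact ((γ : SLR n) ^ k) x ∈ ℳ ∧ Φ (lact ((γ : SLR n) ^ k) x) = (ρ γ)^[k] (Φ x) := by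
    intro k
    induction k with
    | zero => intro x hx; simpa [lact_one] using hx
    | succ k ih =>
      intro x hx
      obtain ⟨h1, h2⟩ := ih x hx
      rw [pow_succ', lact_mul, Function.iterate_succ_apply', ← h2]
      exact ⟨hX.lact_mem _ γ.2 _ h1, hX.map_lact γ _ h1⟩
  have hloc : ∀ᶠ x in 𝓝 (0 : V n), x ∈ ℳ ∧ Φ x ∈ W :=
    Eventually.and (hX.mem_nhds hX.zero_mem)
      ((hX.continuousOn.continuousAt (hX.mem_nhds hX.zero_mem)).eventually hW)
  intro x U hU N
  have hsmall : Tendsto (fun t : ℝ => t • x) (𝓝[≠] 0) (𝓝 0) := by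
    have : Tendsto (fun t : ℝ => t • x) (𝓝 0) (𝓝 ((0 : ℝ) • x)) :=
      (continuous_id.smul continuous_const).tendsto 0
    rw [zero_smul] at this
    exact this.mono_left nhdsWithin_le_nhds
  obtain ⟨t, ⟨htM, htW⟩, ht⟩ := ((hsmall.eventually hloc).and self_mem_nhdsWithin).exists
  have ht : t ≠ 0 := ht
  have hU' : (fun y : V n => t⁻¹ • y) ⁻¹' U ∈ 𝓝 (t • x) := by
    refine (continuous_const_smul t⁻¹).continuousAt.preimage_mem_nhds ?_
    rwa [inv_smul_smul₀ ht]
  obtain ⟨k, hk, p, ⟨q, ⟨y, ⟨hyU, hyM⟩, hyq⟩, hqp⟩, z, ⟨hzU, hzM⟩, hzp⟩ := hNW _ htW _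
    (hX.image_mem_nhds _ htM _ (inter_mem hU' (hX.mem_nhds htM))) N
  have h1 : lact ((γ : SLR n) ^ k) y = z :=
    hinj (hpow k y hyM).1 hzM (by rw [(hpow k y hyM).2, hyq, hqp, hzp])
  refine ⟨k, hk, t⁻¹ • y, hyU, ?_⟩
  rw [lact_smul, h1]
  exact hzU

end

section

variable {n : ℕ} {M : Type*} [TopologicalSpace M] [ChartedSpace (V n) M]
  {ℳ : Set (V n)} {Φ : V n → M}

lemma LocalAnaDiffeoOn.continuousOn (h : LocalAnaDiffeoOn (V n) (V n) Φ ℳ) : ContinuousOn Φ ℳ := by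
  intro x hx
  obtain ⟨U, -, hxU, -, -, -, hΦ, -⟩ := h x hx
  exact (hΦ x hxU).1.continuousWithinAt

lemma LocalAnaDiffeoOn.image_mem_nhds (h : LocalAnaDiffeoOn (V n) (V n) Φ ℳ) {x : V n}
    (hx : x ∈ ℳ) {U : Set (V n)} (hU : U ∈ 𝓝 x) : Φ '' U ∈ 𝓝 (Φ x) := by
  obtain ⟨U₀, -, hxU, -, -, hopen, -, g, hg, hgan⟩ := h x hx
  have hc : Tendsto g (𝓝 (Φ x)) (𝓝 (g (Φ x))) := (hgan _ (mem_image_of_mem _ hxU)).1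
  rw [hg hxU] at hc
  filter_upwards [hopen.mem_nhds (mem_image_of_mem _ hxU), hc hU]
  rintro _ ⟨y, hy, rfl⟩ hyU
  rw [mem_preimage, hg hy] at hyU
  exact mem_image_of_mem _ hyU

lemma LocalAnaDiffeoOn.germ (h : LocalAnaDiffeoOn (V n) (V n) Φ ℳ) {u v : V n}
    (hu : u ∈ ℳ) (hv : v ∈ ℳ) (huv : Φ u = Φ v) :
    ∃ h : V n → V n, AnalyticAt ℝ h u ∧ h u = v ∧ ∀ᶠ x in 𝓝 u, Φ (h x) = Φ x := by
  obtain ⟨U, -, huU, -, -, -, hΦ, -⟩ := h u hu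
  obtain ⟨U', -, hvU, -, -, hopen, -, g, hg, hgan⟩ := h v hv
  have hmem : Φ u ∈ Φ '' U' := huv ▸ mem_image_of_mem _ hvU
  obtain ⟨hc, ha⟩ := hΦ u huU
  have ha : AnalyticAt ℝ (chartAt (V n) (Φ u) ∘ Φ) u := ha
  have hga : AnalyticAt ℝ (g ∘ (chartAt (V n) (Φ u)).symm) (chartAt (V n) (Φ u) (Φ u)) :=
    (hgan (Φ u) hmem).2
  refine ⟨g ∘ Φ, ?_, ?_, ?_⟩
  · have hcomp := AnalyticAt.comp (g := g ∘ (chartAt (V n) (Φ u)).symm)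
      (f := chartAt (V n) (Φ u) ∘ Φ) hga ha
    refine hcomp.congr ?_
    filter_upwards [hc ((chartAt (V n) (Φ u)).open_source.mem_nhds (mem_chart_source _ _))]
      with x hx
    simp [(chartAt (V n) (Φ u)).left_inv hx]
  · rw [Function.comp_apply, huv, hg hvU]
  · filter_upwards [hc (hopen.mem_nhds hmem)]
    rintro x ⟨y, hy, hxy⟩
    rw [Function.comp_apply, ← hxy, hg hy]

lemma GoodExt.linExt {Γ : Subgroup (SLR n)} {ρ : Γ → M → M} {φ : V n → M}
    (h : GoodExt (fun γ : Γ => lact (γ : SLR n)) ρ φ ℳ Φ) : LinExt Γ ρ ℳ Φ := by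
  obtain ⟨hopen, -, h0, hinv, -, hloc, hequiv⟩ := h
  refine ⟨hopen, h0, fun γ hγ => hinv ⟨γ, hγ⟩, hequiv, hloc.continuousOn, fun x hx => ?_,
    fun x hx U hU => hloc.image_mem_nhds hx hU, fun u hu v hv huv => hloc.germ hu hv huv⟩
  obtain ⟨U, hU, hxU, -, hinj, -⟩ := hloc x hx
  exact ⟨U, hU.mem_nhds hxU, hinj⟩

lemma SiegelData.map_zero {Γ : Subgroup (SLR n)} {ρ : Γ →* Equiv.Perm M} {x₀ : M} {φ : V n → M}
    (hS : SiegelData Γ ρ x₀ φ ℳ Φ) : Φ 0 = x₀ := by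
  obtain ⟨-, hφ, -, ⟨-, -, -, -, hev, -⟩, -⟩ := hS
  rw [hev.self_of_nhds, hφ.1]

end

/-- In the Siegel setup, the conservative case (`Φ` not injective) occurs
if and only if either `Γ` preserves a finite non-atomic measure whose support contains
`x₀`, or some infinite-order element `γ ∈ Γ` has a set of non-wandering points containing
a neighborhood of `x₀`. -/
theorem statement_7 (n : ℕ) (hn : 3 ≤ n) (Γ : Subgroup (SLR n))
    (hlat : IsLatticeIn (SLR n) Γ)
    (M : Type*) [TopologicalSpace M] [T2Space M] [ChartedSpace (V n) M]
    [MeasurableSpace M] [BorelSpace M]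
    (hM : AnalyticCharts (V n) M)
    (ρ : Γ →* Equiv.Perm M) (hfaithful : Function.Injective ρ)
    (hρ : ∀ γ : Γ, CAnalytic (V n) (V n) ⇑(ρ γ))
    (x₀ : M) (φ : V n → M) (ℳ : Set (V n)) (Φ : V n → M)
    (hS : SiegelData Γ ρ x₀ φ ℳ Φ) :
    ¬ InjOn Φ ℳ ↔
      ((∃ μ : Measure M, IsFiniteMeasure μ ∧ (∀ x : M, μ {x} = 0) ∧
          (∀ γ : Γ, Measure.map (ρ γ) μ = μ) ∧
          (∀ U : Set M, IsOpen U → x₀ ∈ U → μ U ≠ 0)) ∨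
        (∃ γ : Γ, ¬ IsOfFinOrder γ ∧
          ∃ W ∈ 𝓝 x₀, ∀ x ∈ W, NonWanderingPt (ρ γ) x)) := by
  have hX : LinExt Γ (fun γ => ρ γ) ℳ Φ := hS.2.2.2.1.linExt
  have hcont : ∀ γ : Γ, Continuous (ρ γ) := fun γ =>
    continuous_iff_continuousAt.2 fun x => (hρ γ x).1
  obtain rfl := hS.map_zero
  refine ⟨fun hinj => Or.inl (hX.exists_invariant_measure hn hlat hinj hcont), ?_⟩
  rintro (⟨μ, hfin, h0, hμ, hsupp⟩ | ⟨γ, hγ, W, hW, hNW⟩)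
  · exact hX.not_injOn_of_measure hn hlat hcont (h0 _) hμ hsupp
  · intro hinj
    have := hlat.1
    exact hγ (hX.recurs_of_nonWandering hinj hW hNW).isOfFinOrder
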